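/- arXiv:2108.13076 — 3 statements merged into one kernel-verified Lean document; each statement's English description precedes it below -/
import Mathlib

section
/- Let R' be a partial representation of a graph G that extends to a proper Helly circular-arc representation of G. Then R' extends to a normal proper Helly circular-arc representation of G if and only if no two predrawn arcs of R' are in non-normal position. -/
open Set

noncomputable section

/-- The closed arc on the circle `AddCircle L` (circle of circumference `L`) whose
tail is `t` and which proceeds clockwise for length `len` (ending at its head
`t + len`). -/
def Arc (L : ℝ) (t : AddCircle L) (len : ℝ) : Set (AddCircle L) :=
  {x : AddCircle L | ∃ s : ℝ, 0 ≤ s ∧ s ≤ len ∧ x = t + (s : AddCircle L)}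

/-- A circular-arc representation of the (finite simple) graph `G` on a circle of
circumference `L`: every vertex `v` gets a closed arc (recorded by its tail and its
length, with `0 ≤ len v < L`), and two arcs of distinct vertices intersect iff the
vertices are adjacent. -/
structure CARep {V : Type*} (G : SimpleGraph V) (L : ℝ) where
  hL : 0 < L
  tail : V → AddCircle L
  len : V → ℝ
  len_nonneg : ∀ v, 0 ≤ len v
  len_lt : ∀ v, len v < L
  inter_iff : ∀ u v : V, u ≠ v →
    ((Arc L (tail u) (len u) ∩ Arc L (tail v) (len v)).Nonempty ↔ G.Adj u v)

namespace CARep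

variable {V : Type*} {G : SimpleGraph V} {L : ℝ}

/-- The arc of vertex `v`. -/
def arc (R : CARep G L) (v : V) : Set (AddCircle L) := Arc L (R.tail v) (R.len v)

/-- The head (clockwise endpoint) of the arc of `v`. -/
def head (R : CARep G L) (v : V) : AddCircle L := R.tail v + ((R.len v : ℝ) : AddCircle L)

/-- A representation is Helly if every nonempty family of pairwise intersecting arcs
has a common point. -/
def Helly (R : CARep G L) : Prop :=
  ∀ S : Set V, S.Nonempty → (∀ u ∈ S, ∀ v ∈ S, (R.arc u ∩ R.arc v).Nonempty) →
    (⋂ v ∈ S, R.arc v).Nonempty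

/-- A representation is normal if the intersection of any two arcs is empty or
connected. -/
def Normal (R : CARep G L) : Prop :=
  ∀ u v : V, u ≠ v → IsPreconnected (R.arc u ∩ R.arc v)

/-- A representation is proper if no arc is properly contained in another. -/
def Proper (R : CARep G L) : Prop := ∀ u v : V, ¬ R.arc u ⊂ R.arc v

/-- A representation is unit if every arc has length exactly one. -/
def IsUnit (R : CARep G L) : Prop := ∀ v, R.len v = 1

end CARep

/-- A partial circular-arc representation of `G`: a circular-arc representation of the
subgraph of `G` induced by the set `pre` of predrawn vertices.  (The fields `tail`/`len`
are total functions; only their values on `pre` are meaningful.) -/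
structure PartialCARep {V : Type*} (G : SimpleGraph V) (L : ℝ) where
  hL : 0 < L
  pre : Set V
  tail : V → AddCircle L
  len : V → ℝ
  len_nonneg : ∀ v ∈ pre, 0 ≤ len v
  len_lt : ∀ v ∈ pre, len v < L
  inter_iff : ∀ u ∈ pre, ∀ v ∈ pre, u ≠ v →
    ((Arc L (tail u) (len u) ∩ Arc L (tail v) (len v)).Nonempty ↔ G.Adj u v)

namespace PartialCARep

variable {V : Type*} {G : SimpleGraph V} {L : ℝ}

/-- The (predrawn) arc of vertex `v`. -/
def arc (R' : PartialCARep G L) (v : V) : Set (AddCircle L) := Arc L (R'.tail v) (R'.len v)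

/-- The head (clockwise endpoint) of the predrawn arc of `v`. -/
def head (R' : PartialCARep G L) (v : V) : AddCircle L :=
  R'.tail v + ((R'.len v : ℝ) : AddCircle L)

/-- The partial representation is Helly. -/
def Helly (R' : PartialCARep G L) : Prop :=
  ∀ S : Set V, S ⊆ R'.pre → S.Nonempty →
    (∀ u ∈ S, ∀ v ∈ S, (R'.arc u ∩ R'.arc v).Nonempty) →
    (⋂ v ∈ S, R'.arc v).Nonempty

/-- The partial representation is normal. -/
def Normal (R' : PartialCARep G L) : Prop :=
  ∀ u ∈ R'.pre, ∀ v ∈ R'.pre, u ≠ v → IsPreconnected (R'.arc u ∩ R'.arc v)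

/-- The partial representation is proper. -/
def Proper (R' : PartialCARep G L) : Prop :=
  ∀ u ∈ R'.pre, ∀ v ∈ R'.pre, ¬ R'.arc u ⊂ R'.arc v

/-- `Pre(C)`: the set of predrawn arcs of vertices of `C`. -/
def PreArcs (R' : PartialCARep G L) (C : Set V) : Set (Set (AddCircle L)) :=
  {A | ∃ v ∈ R'.pre ∩ C, A = R'.arc v}

/-- All predrawn arcs. -/
def AllArcs (R' : PartialCARep G L) : Set (Set (AddCircle L)) :=
  {A | ∃ v ∈ R'.pre, A = R'.arc v}

/-- `Reg⁺(C)`: the intersection of the arcs of `Pre(C)` (the whole circle if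
`Pre(C) = ∅`). -/
def RegPlus (R' : PartialCARep G L) (C : Set V) : Set (AddCircle L) := ⋂₀ R'.PreArcs C

/-- `Reg⁻(C)`: the union of the predrawn arcs not in `Pre(C)`. -/
def RegMinus (R' : PartialCARep G L) (C : Set V) : Set (AddCircle L) :=
  ⋃₀ (R'.AllArcs \ R'.PreArcs C)

/-- The region `Reg(C) = Reg⁺(C) \ Reg⁻(C)`. -/
def Reg (R' : PartialCARep G L) (C : Set V) : Set (AddCircle L) :=
  R'.RegPlus C \ R'.RegMinus C

/-- `J` is a gap of `C`: a connected component of the complement of `Reg(C)`. -/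
def IsGap (R' : PartialCARep G L) (C : Set V) (J : Set (AddCircle L)) : Prop :=
  ∃ x ∈ (R'.Reg C)ᶜ, J = connectedComponentIn (R'.Reg C)ᶜ x

end PartialCARep

/-- `R` extends the partial representation `R'`: predrawn vertices keep their arcs. -/
def CARep.Extends {V : Type*} {G : SimpleGraph V} {L : ℝ}
    (R : CARep G L) (R' : PartialCARep G L) : Prop :=
  ∀ v ∈ R'.pre, R.arc v = R'.arc v

/-- An interval representation of `G`: closed intervals `[lo v, hi v]` on the real
line, intersecting iff the vertices are adjacent. -/
structure IntervalRep {V : Type*} (G : SimpleGraph V) where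
  lo : V → ℝ
  hi : V → ℝ
  lo_le_hi : ∀ v, lo v ≤ hi v
  inter_iff : ∀ u v : V, u ≠ v →
    ((Set.Icc (lo u) (hi u) ∩ Set.Icc (lo v) (hi v)).Nonempty ↔ G.Adj u v)

/-- The interval of vertex `v`. -/
def IntervalRep.itv {V : Type*} {G : SimpleGraph V} (R : IntervalRep G) (v : V) : Set ℝ :=
  Set.Icc (R.lo v) (R.hi v)

/-- `C` is a maximal clique of `G`. -/
def IsMaxClique {V : Type*} (G : SimpleGraph V) (C : Set V) : Prop :=
  G.IsClique C ∧ ∀ D : Set V, G.IsClique D → C ⊆ D → C = D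

/-- The closed neighborhood `N[v]`. -/
def closedNbhd {V : Type*} (G : SimpleGraph V) (v : V) : Set V :=
  insert v {u | G.Adj v u}

/-- `v` is a universal vertex: adjacent to all other vertices. -/
def IsUniversalVertex {V : Type*} (G : SimpleGraph V) (v : V) : Prop :=
  ∀ w, w ≠ v → G.Adj v w

/-- `u, w` form a universal pair: they are adjacent and every vertex is adjacent
to `u` or to `w`. -/
def IsUniversalPair {V : Type*} (G : SimpleGraph V) (u w : V) : Prop :=
  G.Adj u w ∧ ∀ x, G.Adj u x ∨ G.Adj w x

/-- The cyclic interval of length `m` starting at `a` in `ZMod k`. -/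
def ZInterval {k : ℕ} (a : ZMod k) (m : ℕ) : Set (ZMod k) :=
  {x | ∃ i : ℕ, i < m ∧ x = a + (i : ZMod k)}

/-- `T` is consecutive in the cyclic ordering induced by the labelling `f`. -/
def CyclicConsec {α : Type*} {k : ℕ} (f : α → ZMod k) (T : Set α) : Prop :=
  ∃ (a : ZMod k) (m : ℕ), T = f ⁻¹' ZInterval a m

/-- The cyclic position (in `ZMod k`) of an element under the enumeration `e`;
this turns the linear ordering `e` into a cyclic ordering. -/
def zOrd {α : Type*} {k : ℕ} (e : α ≃ Fin k) (x : α) : ZMod k := ((e x : ℕ) : ZMod k)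

/-- Cyclic betweenness in `ZMod k`: starting at `a` and going forward one meets
`b` and then `c` within one revolution. -/
def ZBtw {k : ℕ} (a b c : ZMod k) : Prop :=
  ∃ s t : ℕ, s ≤ t ∧ t < k ∧ b = a + (s : ZMod k) ∧ c = a + (t : ZMod k)

/-- Cyclic betweenness on the circle: starting at `a` and going clockwise one meets
`b` and then `c` within one revolution. -/
def CBtw (L : ℝ) (a b c : AddCircle L) : Prop :=
  ∃ s t : ℝ, 0 ≤ s ∧ s ≤ t ∧ t < L ∧ b = a + (s : AddCircle L) ∧ c = a + (t : AddCircle L)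

/-- The position of the point `x` in the linear order of circle points obtained by
cutting the circle at the point `p`: the unique `s ∈ [0, L)` with `x = p + s`. -/
noncomputable def circPos (L : ℝ) (hL : 0 < L) (p x : AddCircle L) : ℝ :=
  haveI : Fact (0 < L) := ⟨hL⟩
  ((AddCircle.equivIco L 0) (x - p) : ℝ)

/-- Two arcs are in non-normal position: their intersection is nonempty and
disconnected. -/
def NonNormalPos {L : ℝ} (A B : Set (AddCircle L)) : Prop :=
  (A ∩ B).Nonempty ∧ ¬ IsPreconnected (A ∩ B)
/-- An arc missing the point `a` is the image of an interval in `(a, a + L)`. -/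
lemma arc_eq_image {L : ℝ} (hL : 0 < L) (t : AddCircle L) (len a : ℝ) (hlen : 0 ≤ len)
    (ha : (a : AddCircle L) ∉ Arc L t len) :
    ∃ b c : ℝ, Icc b c ⊆ Ioo a (a + L) ∧
      Arc L t len = (fun x : ℝ => (x : AddCircle L)) '' Icc b c := by
  haveI : Fact (0 < L) := ⟨hL⟩
  obtain ⟨b, hb, rfl⟩ := AddCircle.eq_coe_Ico t
  obtain ⟨b, hb, hbt⟩ : ∃ b' : ℝ, b' ∈ Ico a (a + L) ∧ (b' : AddCircle L) = b :=
    ⟨toIcoMod hL a b, toIcoMod_mem_Ico hL a b, by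
      rw [toIcoMod, AddCircle.coe_sub, AddCircle.coe_zsmul, AddCircle.coe_period, smul_zero,
        sub_zero]⟩
  rw [← hbt] at ha ⊢
  refine ⟨b, b + len, ?_, ?_⟩
  · intro y hy
    have h1 : a ≠ b := by
      rintro rfl
      exact ha ⟨0, le_rfl, hlen, by simp⟩
    have h2 : b + len < a + L := by
      by_contra hcon
      push Not at hcon
      refine ha ⟨a + L - b, by linarith [hb.2], by linarith, ?_⟩
      rw [← AddCircle.coe_add]
      have : b + (a + L - b) = a + L := by ring
      rw [this]; simp
    exact ⟨lt_of_lt_of_le (lt_of_le_of_ne hb.1 h1) hy.1, lt_of_le_of_lt hy.2 h2⟩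
  · ext x
    constructor
    · rintro ⟨s, h0, h1, rfl⟩
      exact ⟨b + s, ⟨by linarith, by linarith⟩, by simp⟩
    · rintro ⟨y, hy, rfl⟩
      exact ⟨y - b, by linarith [hy.1], by linarith [hy.2], by simp⟩

lemma arc_preconnected {L : ℝ} (t : AddCircle L) (len : ℝ) : IsPreconnected (Arc L t len) := by
  have : Arc L t len = (fun s : ℝ => t + (s : AddCircle L)) '' Icc 0 len := by
    ext x
    constructor
    · rintro ⟨s, h0, h1, rfl⟩
      exact ⟨s, ⟨h0, h1⟩, rfl⟩
    · rintro ⟨s, hs, rfl⟩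
      exact ⟨s, hs.1, hs.2, rfl⟩
  rw [this]
  refine isPreconnected_Icc.image _ (Continuous.continuousOn ?_)
  exact continuous_const.add (AddCircle.continuous_mk' L)

/-- Two arcs not covering the circle have preconnected intersection. -/
lemma inter_preconnected {L : ℝ} (hL : 0 < L) (t t' : AddCircle L) (l l' : ℝ)
    (hl : 0 ≤ l) (hl' : 0 ≤ l') (p : AddCircle L) (hp : p ∉ Arc L t l) (hp' : p ∉ Arc L t' l') :
    IsPreconnected (Arc L t l ∩ Arc L t' l') := by
  haveI : Fact (0 < L) := ⟨hL⟩
  obtain ⟨a, -, rfl⟩ := AddCircle.eq_coe_Ico p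
  obtain ⟨b, c, h1, e1⟩ := arc_eq_image hL t l a hl hp
  obtain ⟨b', c', h2, e2⟩ := arc_eq_image hL t' l' a hl' hp'
  have hinj : InjOn (fun x : ℝ => (x : AddCircle L)) (Ioo a (a + L)) := by
    intro x hx y hy hxy
    exact (AddCircle.coe_eq_coe_iff_of_mem_Ico (p := L) (a := a)
      ⟨hx.1.le, hx.2⟩ ⟨hy.1.le, hy.2⟩).1 hxy
  rw [e1, e2, ← hinj.image_inter h1 h2, Icc_inter_Icc]
  exact isPreconnected_Icc.image _ (AddCircle.continuous_mk' L).continuousOn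

/-- In a proper representation, a vertex in non-normal position meets every arc. -/
lemma meets_all {V : Type*} {G : SimpleGraph V} {L : ℝ} (R : CARep G L) (hP : R.Proper)
    (u w : V) (h : ¬ IsPreconnected (R.arc u ∩ R.arc w)) (x : V) :
    (R.arc u ∩ R.arc x).Nonempty := by
  by_contra hne
  rw [not_nonempty_iff_eq_empty] at hne
  have hsub : R.arc x ⊆ R.arc w := by
    intro p hp
    by_contra hpw
    have hpu : p ∉ R.arc u := fun hpu => by
      have : p ∈ R.arc u ∩ R.arc x := ⟨hpu, hp⟩
      rw [hne] at this
      exact this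
    exact h (inter_preconnected R.hL _ _ _ _ (R.len_nonneg u) (R.len_nonneg w) p hpu hpw)
  rcases eq_or_ssubset_of_subset hsub with he | hs
  · rw [← he, hne] at h
    exact h isPreconnected_empty
  · exact hP x w hs

/-- If a partial representation `R'` extends to a proper Helly
circular-arc representation of `G`, then `R'` extends to a *normal* proper Helly
circular-arc representation of `G` iff no two predrawn arcs are in non-normal
position. -/
theorem phca_to_nphca_extension {V : Type*} [Fintype V] (G : SimpleGraph V)
    (L : ℝ) (R' : PartialCARep G L)
    (hext : ∃ R : CARep G L, R.Extends R' ∧ R.Proper ∧ R.Helly) :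
    (∃ R : CARep G L, R.Extends R' ∧ R.Normal ∧ R.Proper ∧ R.Helly) ↔
    (∀ u ∈ R'.pre, ∀ v ∈ R'.pre, u ≠ v → ¬ NonNormalPos (R'.arc u) (R'.arc v)) := by
  constructor
  · rintro ⟨R, hE, hN, -, -⟩ u hu v hv huv ⟨-, h⟩
    rw [← hE u hu, ← hE v hv] at h
    exact h (hN u v huv)
  · intro hno
    obtain ⟨R, hE, hP, hH⟩ := hext
    classical
    set U : Set V := {u | ∃ w, ¬ IsPreconnected (R.arc u ∩ R.arc w)} with hU
    by_cases hUe : U.Nonempty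
    swap
    · refine ⟨R, hE, fun u v _ => ?_, hP, hH⟩
      by_contra h
      exact hUe ⟨u, v, h⟩
    obtain ⟨p, hpU, hpre⟩ : ∃ p ∈ U, ∀ q ∈ U, q ∈ R'.pre → p ∈ R'.pre := by
      by_cases h : ∃ q ∈ U, q ∈ R'.pre
      · obtain ⟨q, h1, h2⟩ := h
        exact ⟨q, h1, fun _ _ _ => h2⟩
      · obtain ⟨q, h1⟩ := hUe
        exact ⟨q, h1, fun q' h2 h3 => (h ⟨q', h2, h3⟩).elim⟩
    have hmeet : ∀ u ∈ U, ∀ x, (R.arc u ∩ R.arc x).Nonempty := by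
      rintro u ⟨w, hw⟩ x
      exact meets_all R hP u w hw x
    set f : V → V := fun v => if v ∈ U ∧ v ∉ R'.pre then p else v with hf
    have hf1 : ∀ v, v ∈ U → v ∉ R'.pre → f v = p := fun v h1 h2 => if_pos ⟨h1, h2⟩
    have hf2 : ∀ v, ¬ (v ∈ U ∧ v ∉ R'.pre) → f v = v := fun v h => if_neg h
    have hfU : ∀ v, v ∈ U → f v ∈ U := by
      intro v hv
      by_cases h : v ∈ R'.pre
      · rw [hf2 v (fun h' => h'.2 h)]; exact hv
      · rw [hf1 v hv h]; exact hpU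
    have hfn : ∀ v, v ∉ U → f v = v := fun v hv => hf2 v fun h => hv h.1
    have hiff : ∀ u v : V, u ≠ v →
        ((R.arc (f u) ∩ R.arc (f v)).Nonempty ↔ G.Adj u v) := by
      intro u v huv
      by_cases hu : u ∈ U
      · exact ⟨fun _ => (R.inter_iff u v huv).1 (hmeet u hu v), fun _ => hmeet _ (hfU u hu) _⟩
      by_cases hv : v ∈ U
      · refine ⟨fun _ => ((R.inter_iff v u huv.symm).1 (hmeet v hv u)).symm, fun _ => ?_⟩
        rw [inter_comm]
        exact hmeet _ (hfU v hv) _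
      rw [hfn u hu, hfn v hv]
      exact R.inter_iff u v huv
    let S : CARep G L :=
      { hL := R.hL
        tail := fun v => R.tail (f v)
        len := fun v => R.len (f v)
        len_nonneg := fun v => R.len_nonneg _
        len_lt := fun v => R.len_lt _
        inter_iff := hiff }
    have hS : ∀ v, S.arc v = R.arc (f v) := fun _ => rfl
    refine ⟨S, ?_, ?_, ?_, ?_⟩
    · intro v hv
      rw [hS, hf2 v (fun h => h.2 hv)]
      exact hE v hv
    · intro u v huv
      rw [hS, hS]
      by_contra h
      have h1 : f u ∈ U := ⟨_, h⟩
      have h2 : f v ∈ U := ⟨f u, by rwa [inter_comm]⟩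
      have hne : f u ≠ f v := by
        intro he
        rw [he, inter_self] at h
        exact h (arc_preconnected _ _)
      have key : ∀ x, f x ∈ U → f x ∉ R'.pre → f x = p := by
        intro x hx hx'
        by_cases hc : x ∈ U ∧ x ∉ R'.pre
        · exact hf1 x hc.1 hc.2
        · rw [hf2 x hc] at hx hx'
          exact (hc ⟨hx, hx'⟩).elim
      have hpp : ∀ x y, f x ∈ U → f y ∈ U → f x ≠ f y → f x ∈ R'.pre := by
        intro x y hx hy hxy
        by_contra hx'
        have e1 := key x hx hx'
        have hp' : p ∉ R'.pre := e1 ▸ hx'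
        have hy' : f y ∉ R'.pre := fun h => hp' (hpre _ hy h)
        exact hxy (e1.trans (key y hy hy').symm)
      have m1 := hpp u v h1 h2 hne
      have m2 := hpp v u h2 h1 hne.symm
      refine hno _ m1 _ m2 hne ?_
      rw [← hE _ m1, ← hE _ m2]
      exact ⟨hmeet _ h1 _, h⟩
    · intro u v
      exact hP (f u) (f v)
    · intro T hT hTT
      obtain ⟨z, hz⟩ := hH (f '' T) (hT.image f) (by
        rintro _ ⟨u, hu, rfl⟩ _ ⟨v, hv, rfl⟩
        exact hTT u hu v hv)
      refine ⟨z, ?_⟩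
      simp only [mem_iInter] at hz ⊢
      exact fun v hv => hz (f v) ⟨v, hv, rfl⟩
end
end

section
/- Let W_4 be the wheel on five vertices, obtained from the cycle C_4 by adding a vertex adjacent to all four cycle vertices. Then W_4 has a Helly circular-arc representation and a normal circular-arc representation, but it has no normal Helly circular-arc representation. -/
open Set

noncomputable section

/-- The wheel `W₄`: the 4-cycle `0-1-2-3-0` together with the hub `4` adjacent to all
four cycle vertices. -/
def W4 : SimpleGraph (Fin 5) :=
  SimpleGraph.fromRel (fun a b =>
    a = 4 ∨ b = 4 ∨ (a.val + 1) % 4 = b.val ∨ (b.val + 1) % 4 = a.val)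

theorem w4_coe_inj {L x y : ℝ} (hL : 0 < L) (h : (x : AddCircle L) = (y : AddCircle L))
    (h1 : x - y < L) (h2 : y - x < L) : x = y := by
  have h3 : ((x - y : ℝ) : AddCircle L) = 0 := by rw [AddCircle.coe_sub, h, sub_self]
  rw [AddCircle.coe_eq_zero_iff] at h3
  obtain ⟨n, hn⟩ := h3
  rw [zsmul_eq_mul] at hn
  have hn1 : n < 1 := by
    by_contra hc
    have : (1 : ℝ) ≤ n := by exact_mod_cast not_lt.mp hc
    nlinarith
  have hn2 : -1 < n := by
    by_contra hc
    have : (n : ℝ) ≤ -1 := by exact_mod_cast not_lt.mp hc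
    nlinarith
  have : n = 0 := by omega
  subst this
  simp at hn
  linarith

theorem w4_arc_inter_eq {L a l c m : ℝ} (hL : 0 < L) (h1 : a + l < L + c) (h2 : c + m < L + a) :
    Arc L (a : AddCircle L) l ∩ Arc L (c : AddCircle L) m =
      (fun x : ℝ => (x : AddCircle L)) '' Icc (max a c) (min (a + l) (c + m)) := by
  ext x
  constructor
  · rintro ⟨⟨s, hs0, hs1, rfl⟩, ⟨t, ht0, ht1, h⟩⟩
    rw [← AddCircle.coe_add, ← AddCircle.coe_add] at h
    have h := w4_coe_inj hL h (by linarith) (by linarith)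
    refine ⟨a + s, ⟨max_le ?_ ?_, le_min ?_ ?_⟩, AddCircle.coe_add _ _ _⟩ <;> linarith
  · rintro ⟨x, ⟨hx1, hx2⟩, rfl⟩
    have e1 := le_trans (le_max_left _ _) hx1
    have e2 := le_trans (le_max_right _ _) hx1
    have e3 := le_trans hx2 (min_le_left _ _)
    have e4 := le_trans hx2 (min_le_right _ _)
    refine ⟨⟨x - a, by linarith, by linarith, ?_⟩, ⟨x - c, by linarith, by linarith, ?_⟩⟩
    · rw [← AddCircle.coe_add]; congr 1; ring
    · rw [← AddCircle.coe_add]; congr 1; ring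

theorem w4_inter_preconn {L a l c m : ℝ} (hL : 0 < L) (h1 : a + l < L + c)
    (h2 : c + m < L + a) :
    IsPreconnected (Arc L (a : AddCircle L) l ∩ Arc L (c : AddCircle L) m) := by
  rw [w4_arc_inter_eq hL h1 h2]
  exact isPreconnected_Icc.image _ (AddCircle.continuous_mk' L).continuousOn

theorem w4_inter_empty {L a l c m : ℝ} (hL : 0 < L) (h1 : a + l < c)
    (h2 : c + m < L + a) :
    ¬ (Arc L (a : AddCircle L) l ∩ Arc L (c : AddCircle L) m).Nonempty := by
  rw [w4_arc_inter_eq hL (by linarith) h2]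
  rintro ⟨_, x, ⟨hx1, hx2⟩, _⟩
  have e2 := le_trans (le_max_right _ _) hx1
  have e3 := le_trans hx2 (min_le_left _ _)
  linarith

theorem w4_mem {L a l x : ℝ} (h1 : a ≤ x) (h2 : x ≤ a + l) :
    (x : AddCircle L) ∈ Arc L (a : AddCircle L) l := by
  refine ⟨x - a, by linarith, by linarith, ?_⟩
  rw [← AddCircle.coe_add]; congr 1; ring

theorem w4_wrap : ((4 : ℝ) : AddCircle (4 : ℝ)) = ((0 : ℝ) : AddCircle (4 : ℝ)) := by
  rw [AddCircle.coe_period, AddCircle.coe_zero]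

theorem w4_wrap3 : ((3 : ℝ) : AddCircle (4 : ℝ)) = ((-1 : ℝ) : AddCircle (4 : ℝ)) := by
  rw [← AddCircle.coe_add_period (4 : ℝ) (-1)]; norm_num

/-- Tails of the explicit representations on the circle of circumference `4`. -/
def w4T (a : ℝ) : Fin 5 → ℝ := ![0, 1, 2, 3, a]

/-- Lengths of the explicit representations. -/
def w4Len (a : ℝ) : Fin 5 → ℝ := ![1, 1, 1, 1, 3 - a]

theorem w4_inter_lt (a : ℝ) (h0 : 0 ≤ a) (h1 : a ≤ 1) (u v : Fin 5) (huv : u < v) :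
    (Arc 4 (w4T a u : AddCircle (4 : ℝ)) (w4Len a u) ∩
      Arc 4 (w4T a v : AddCircle (4 : ℝ)) (w4Len a v)).Nonempty ↔ W4.Adj u v := by
  fin_cases u <;> fin_cases v <;> simp at huv <;>
    simp only [W4, SimpleGraph.fromRel_adj, w4T, w4Len]
  · exact iff_of_true ⟨_, w4_mem (x := 1) (by simp) (by simp), w4_mem (by simp) (by simp)⟩
      (by decide)
  · exact iff_of_false (w4_inter_empty (by norm_num) (by norm_num) (by norm_num)) (by decide)
  · refine iff_of_true ⟨((0 : ℝ) : AddCircle (4 : ℝ)), w4_mem (by simp) (by simp), ?_⟩ (by decide)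
    rw [← w4_wrap]
    exact w4_mem (by norm_num) (by norm_num)
  · exact iff_of_true ⟨_, w4_mem (x := 1) (by simp) (by simp), w4_mem (by simpa) (by simp)⟩
      (by decide)
  · exact iff_of_true ⟨_, w4_mem (x := 2) (by simp) (by norm_num), w4_mem (by simp) (by simp)⟩
      (by decide)
  · exact iff_of_false (w4_inter_empty (by norm_num) (by norm_num) (by norm_num)) (by decide)
  · exact iff_of_true ⟨_, w4_mem (x := 1) (by simp) (by simp), w4_mem (by simpa) (by simp)⟩
      (by decide)
  · exact iff_of_true ⟨_, w4_mem (x := 3) (by norm_num) (by norm_num),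
      w4_mem (by simp) (by simp)⟩ (by decide)
  · exact iff_of_true ⟨_, w4_mem (x := 2) (by norm_num) (by norm_num),
      w4_mem (by simp; linarith) (by simp; linarith)⟩ (by decide)
  · exact iff_of_true ⟨_, w4_mem (x := 3) (by norm_num) (by norm_num),
      w4_mem (by simp; linarith) (by simp)⟩ (by decide)

/-- The explicit representation with hub `[a, 3]`. -/
def w4Rep (a : ℝ) (h0 : 0 ≤ a) (h1 : a ≤ 1) : CARep W4 4 where
  hL := by norm_num
  tail v := (w4T a v : AddCircle (4 : ℝ))
  len := w4Len a
  len_nonneg v := by fin_cases v <;> simp [w4Len] <;> linarith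
  len_lt v := by fin_cases v <;> simp [w4Len] <;> linarith
  inter_iff u v huv := by
    rcases lt_or_gt_of_ne huv with h | h
    · exact w4_inter_lt a h0 h1 u v h
    · rw [inter_comm, W4.adj_comm]
      exact w4_inter_lt a h0 h1 v u h

theorem w4_normal : (w4Rep 1 (by norm_num) (by norm_num)).Normal := by
  have key : ∀ u v : Fin 5, u < v → IsPreconnected
      (Arc 4 (w4T 1 u : AddCircle (4 : ℝ)) (w4Len 1 u) ∩
        Arc 4 (w4T 1 v : AddCircle (4 : ℝ)) (w4Len 1 v)) := by
    intro u v huv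
    by_cases h : u = 0 ∧ v = 3
    · obtain ⟨rfl, rfl⟩ := h
      have e : w4T 1 3 = 3 := rfl
      rw [e, w4_wrap3]
      have e0 : w4T 1 0 = 0 := rfl
      have e1 : w4Len 1 0 = 1 := rfl
      have e2 : w4Len 1 3 = 1 := rfl
      rw [e0, e1, e2]
      apply w4_inter_preconn <;> norm_num
    · apply w4_inter_preconn
      · norm_num
      all_goals
        revert h huv
        fin_cases u <;> fin_cases v <;> norm_num [w4T, w4Len]
        try decide
  intro u v huv
  rcases lt_or_gt_of_ne huv with h | h
  · exact key u v h
  · rw [inter_comm]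
    exact key v u h

theorem w4_helly : (w4Rep 0 (by norm_num) (by norm_num)).Helly := by
  intro S _ hS
  set R := w4Rep 0 (by norm_num) (by norm_num) with hR
  have n02 : ¬ (0 ∈ S ∧ 2 ∈ S) := fun h => by
    have := (R.inter_iff 0 2 (by decide)).1 (hS 0 h.1 2 h.2)
    revert this
    simp only [W4, SimpleGraph.fromRel_adj]
    decide
  have n13 : ¬ (1 ∈ S ∧ 3 ∈ S) := fun h => by
    have := (R.inter_iff 1 3 (by decide)).1 (hS 1 h.1 3 h.2)
    revert this
    simp only [W4, SimpleGraph.fromRel_adj]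
    decide
  have mem : ∀ (v : Fin 5) (x : ℝ), w4T 0 v ≤ x → x ≤ w4T 0 v + w4Len 0 v →
      (x : AddCircle (4 : ℝ)) ∈ R.arc v := fun v x h1 h2 => w4_mem h1 h2
  have z3 : ((0 : ℝ) : AddCircle (4 : ℝ)) ∈ R.arc 3 := by
    rw [← w4_wrap]; 
    exact mem 3 4 (show (3 : ℝ) ≤ 4 by norm_num) (show (4 : ℝ) ≤ 3 + 1 by norm_num)
  by_cases h2 : 2 ∈ S
  · have h0 : 0 ∉ S := fun h => n02 ⟨h, h2⟩
    by_cases h3 : 3 ∈ S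
    · have h1 : 1 ∉ S := fun h => n13 ⟨h, h3⟩
      refine ⟨((3 : ℝ) : AddCircle (4 : ℝ)), mem_iInter₂.2 fun v hv => ?_⟩
      fin_cases v
      · exact absurd hv h0
      · exact absurd hv h1
      all_goals exact mem _ _ (by norm_num [w4T]) (by norm_num [w4T, w4Len])
    · refine ⟨((2 : ℝ) : AddCircle (4 : ℝ)), mem_iInter₂.2 fun v hv => ?_⟩
      fin_cases v
      · exact absurd hv h0
      pick_goal 3
      · exact absurd hv h3
      all_goals exact mem _ _ (by norm_num [w4T]) (by norm_num [w4T, w4Len])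
  · by_cases h3 : 3 ∈ S
    · have h1 : 1 ∉ S := fun h => n13 ⟨h, h3⟩
      refine ⟨((0 : ℝ) : AddCircle (4 : ℝ)), mem_iInter₂.2 fun v hv => ?_⟩
      fin_cases v
      · exact mem _ _ (by norm_num [w4T]) (by norm_num [w4T, w4Len])
      · exact absurd hv h1
      · exact absurd hv h2
      · exact z3
      · exact mem _ _ (by norm_num [w4T]) (by norm_num [w4T, w4Len])
    · refine ⟨((1 : ℝ) : AddCircle (4 : ℝ)), mem_iInter₂.2 fun v hv => ?_⟩
      fin_cases v
      · exact mem _ _ (by norm_num [w4T]) (by norm_num [w4T, w4Len])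
      · exact mem _ _ (by norm_num [w4T]) (by norm_num [w4T, w4Len])
      · exact absurd hv h2
      · exact absurd hv h3
      · exact mem _ _ (by norm_num [w4T]) (by norm_num [w4T, w4Len])

/-- A preconnected subset of an arc corresponds to an order-connected set of parameters. -/
theorem w4_ordConn {L : ℝ} (hL : 0 < L) (t : AddCircle L) (l : ℝ) (hl : l < L)
    (A : Set (AddCircle L)) (hA : IsPreconnected (A ∩ Arc L t l)) :
    OrdConnected {s : ℝ | s ∈ Icc 0 l ∧ t + (s : AddCircle L) ∈ A} := by
  haveI : Fact (0 < L) := ⟨hL⟩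
  let f : Icc (0 : ℝ) l → AddCircle L := fun s => t + ((s : ℝ) : AddCircle L)
  have hf : Continuous f :=
    continuous_const.add ((AddCircle.continuous_mk' L).comp continuous_subtype_val)
  have hinj : Function.Injective f := by
    intro x y h
    have h' := add_left_cancel h
    have hx := x.2
    have hy := y.2
    exact Subtype.ext (w4_coe_inj hL h' (by linarith [hx.2, hy.1]) (by linarith [hy.2, hx.1]))
  have hp := hA.preimage_of_isClosedMap hinj hf.isClosedMap (by
    rintro x ⟨_, s, h0, h1, rfl⟩
    exact ⟨⟨s, h0, h1⟩, rfl⟩)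
  have hq := (hp.image _ continuous_subtype_val.continuousOn).ordConnected
  refine ⟨fun x hx y hy z hz => ?_⟩
  have hz' : z ∈ Subtype.val '' (f ⁻¹' (A ∩ Arc L t l)) :=
    hq.out ⟨⟨x, hx.1⟩, ⟨hx.2, x, hx.1.1, hx.1.2, rfl⟩, rfl⟩
      ⟨⟨y, hy.1⟩, ⟨hy.2, y, hy.1.1, hy.1.2, rfl⟩, rfl⟩ hz
  obtain ⟨z', hzA, rfl⟩ := hz'
  exact ⟨z'.2, hzA.1⟩

theorem w4_line {B0 B1 B2 B3 : Set ℝ} (h0 : OrdConnected B0) (h1 : OrdConnected B1)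
    (h2 : OrdConnected B2) (h3 : OrdConnected B3) (h02 : ∀ x ∈ B0, x ∉ B2)
    (h13 : ∀ x ∈ B1, x ∉ B3) {a b c d : ℝ} (a0 : a ∈ B0) (a1 : a ∈ B1) (b1 : b ∈ B1)
    (b2 : b ∈ B2) (c2 : c ∈ B2) (c3 : c ∈ B3) (d3 : d ∈ B3) (d0 : d ∈ B0) : False := by
  have k0 := fun x (h : x ∈ Icc a d) => h02 x (h0.out a0 d0 h)
  have k0' := fun x (h : x ∈ Icc d a) => h02 x (h0.out d0 a0 h)
  have k2 := fun x (h : x ∈ Icc b c) (h' : x ∈ B0) => h02 x h' (h2.out b2 c2 h)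
  have k2' := fun x (h : x ∈ Icc c b) (h' : x ∈ B0) => h02 x h' (h2.out c2 b2 h)
  have k1 := fun x (h : x ∈ Icc a b) => h13 x (h1.out a1 b1 h)
  have k1' := fun x (h : x ∈ Icc b a) => h13 x (h1.out b1 a1 h)
  have k3 := fun x (h : x ∈ Icc c d) (h' : x ∈ B1) => h13 x h' (h3.out c3 d3 h)
  have k3' := fun x (h : x ∈ Icc d c) (h' : x ∈ B1) => h13 x h' (h3.out d3 c3 h)
  simp only [mem_Icc] at *
  grind

theorem w4_no {L : ℝ} (R : CARep W4 L) (hN : R.Normal) (hH : R.Helly) : False := by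
  have adj : ∀ u v, W4.Adj u v → (R.arc u ∩ R.arc v).Nonempty := fun u v h =>
    (R.inter_iff u v h.ne).2 h
  have self : ∀ u, (R.arc u).Nonempty := fun u =>
    ⟨R.tail u + ((0 : ℝ) : AddCircle L), 0, le_rfl, R.len_nonneg u, rfl⟩
  have nonadj : ∀ u v, u ≠ v → ¬ W4.Adj u v → ∀ x ∈ R.arc u, x ∉ R.arc v :=
    fun u v h h' x hu hv => h' ((R.inter_iff u v h).1 ⟨x, hu, hv⟩)
  let B : Fin 5 → Set ℝ := fun v =>
    {s : ℝ | s ∈ Icc 0 (R.len 4) ∧ R.tail 4 + (s : AddCircle L) ∈ R.arc v}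
  have hB : ∀ v, v ≠ 4 → OrdConnected (B v) := fun v hv =>
    w4_ordConn R.hL (R.tail 4) (R.len 4) (R.len_lt 4) (R.arc v) (hN v 4 hv)
  have tri : ∀ u v, W4.Adj u v → W4.Adj u 4 → W4.Adj v 4 → ∃ s, s ∈ B u ∧ s ∈ B v := by
    intro u v huv hu hv
    obtain ⟨x, hx⟩ := hH {u, v, 4} ⟨u, by simp⟩ (by
      rintro p hp q hq
      by_cases hpq : p = q
      · subst hpq; rw [inter_self]; exact self p
      · apply adj
        simp only [mem_insert_iff, mem_singleton_iff] at hp hq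
        rcases hp with rfl | rfl | rfl <;> rcases hq with rfl | rfl | rfl <;>
          first
          | exact absurd rfl hpq
          | assumption
          | (apply SimpleGraph.Adj.symm; assumption))
    rw [mem_iInter₂] at hx
    obtain ⟨s, hs0, hs1, rfl⟩ := hx 4 (by simp)
    exact ⟨s, ⟨⟨hs0, hs1⟩, hx u (by simp)⟩, ⟨⟨hs0, hs1⟩, hx v (by simp)⟩⟩
  have A : ∀ u v : Fin 5, (u ≠ v ∧ ((u = 4 ∨ v = 4 ∨ (u.val + 1) % 4 = v.val ∨
      (v.val + 1) % 4 = u.val) ∨ (v = 4 ∨ u = 4 ∨ (v.val + 1) % 4 = u.val ∨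
      (u.val + 1) % 4 = v.val))) ↔ W4.Adj u v := by
    intro u v
    simp only [W4, SimpleGraph.fromRel_adj]
  obtain ⟨a, a0, a1⟩ := tri 0 1 ((A _ _).1 (by decide)) ((A _ _).1 (by decide))
    ((A _ _).1 (by decide))
  obtain ⟨b, b1, b2⟩ := tri 1 2 ((A _ _).1 (by decide)) ((A _ _).1 (by decide))
    ((A _ _).1 (by decide))
  obtain ⟨c, c2, c3⟩ := tri 2 3 ((A _ _).1 (by decide)) ((A _ _).1 (by decide))
    ((A _ _).1 (by decide))
  obtain ⟨d, d3, d0⟩ := tri 3 0 ((A _ _).1 (by decide)) ((A _ _).1 (by decide))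
    ((A _ _).1 (by decide))
  refine w4_line (hB 0 (by decide)) (hB 1 (by decide)) (hB 2 (by decide)) (hB 3 (by decide))
    ?_ ?_ a0 a1 b1 b2 c2 c3 d3 d0
  · exact fun x hx hx' => nonadj 0 2 (by decide)
      (fun h => absurd ((A _ _).2 h) (by decide)) _ hx.2 hx'.2
  · exact fun x hx hx' => nonadj 1 3 (by decide)
      (fun h => absurd ((A _ _).2 h) (by decide)) _ hx.2 hx'.2

/-- `W₄` has a Helly circular-arc representation and a normal
circular-arc representation, but no normal Helly circular-arc representation. -/
theorem W4_helly_normal_not_normalHelly :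
    (∃ (L : ℝ) (R : CARep W4 L), R.Helly) ∧
    (∃ (L : ℝ) (R : CARep W4 L), R.Normal) ∧
    ¬ (∃ (L : ℝ) (R : CARep W4 L), R.Normal ∧ R.Helly) := by
  refine ⟨⟨4, _, w4_helly⟩, ⟨4, _, w4_normal⟩, ?_⟩
  rintro ⟨L, R, hN, hH⟩
  exact w4_no R hN hH
end
end

section
/- Let R' be a partial Helly circular-arc representation of a graph G in which the predrawn arcs have pairwise distinct endpoints, and let D be a maximal clique of G. Then R' extends to a Helly circular-arc representation of G if and only if there exists a point p_D ∈ Reg(D) such that, for the partial order ≺ on the maximal cliques defined by: D ≺ C for every maximal clique C ≠ D, and C ≺ C' for maximal cliques C, C' ≠ D whenever every point of Reg(C) strictly precedes every point of Reg(C') in the linear order of circle points obtained by cutting the circle at p_D, there exists a linear extension < of ≺ such that: (1) for every vertex v, the set M_v of maximal cliques containing v is consecutive in the cyclic order [<]; and (2) for every gap J of every maximal clique C, the set S_J = {C' : Reg(C') ⊆ J} is consecutive in [<]. -/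
open Set

noncomputable section

section Helpers

/-! ### Basic facts on the circle -/

theorem hca_coe_eq_iff {L : ℝ} (a b : ℝ) :
    ((a : AddCircle L) = (b : AddCircle L)) ↔ ∃ n : ℤ, a = b + n * L := by
  rw [← sub_eq_zero, ← AddCircle.coe_sub, AddCircle.coe_eq_zero_iff]
  constructor
  · rintro ⟨n, hn⟩
    exact ⟨n, by simp at hn; linarith⟩
  · rintro ⟨n, hn⟩
    exact ⟨n, by simp; linarith⟩

theorem hca_exists_lift {L : ℝ} (x : AddCircle L) : ∃ a : ℝ, (a : AddCircle L) = x :=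
  QuotientAddGroup.mk_surjective x

theorem hca_mem_arc {L : ℝ} (t l x : ℝ) :
    ((x : AddCircle L) ∈ Arc L (t : AddCircle L) l) ↔
      ∃ n : ℤ, t ≤ x + n * L ∧ x + n * L ≤ t + l := by
  constructor
  · rintro ⟨s, h0, h1, h⟩
    rw [← AddCircle.coe_add, hca_coe_eq_iff] at h
    obtain ⟨n, hn⟩ := h
    refine ⟨-n, ?_, ?_⟩ <;> push_cast <;> linarith
  · rintro ⟨n, h0, h1⟩
    refine ⟨x + n * L - t, by linarith, by linarith, ?_⟩
    rw [← AddCircle.coe_add, hca_coe_eq_iff]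
    exact ⟨-n, by push_cast; ring⟩

theorem hca_circPos_nonneg {L : ℝ} (hL : 0 < L) (p x : AddCircle L) : 0 ≤ circPos L hL p x := by
  have : Fact (0 < L) := ⟨hL⟩
  exact ((AddCircle.equivIco L 0) (x - p)).2.1

theorem hca_circPos_lt {L : ℝ} (hL : 0 < L) (p x : AddCircle L) : circPos L hL p x < L := by
  have : Fact (0 < L) := ⟨hL⟩
  have := ((AddCircle.equivIco L 0) (x - p)).2.2
  exact this.trans_eq (zero_add L)

theorem hca_circPos_spec {L : ℝ} (hL : 0 < L) (p x : AddCircle L) :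
    p + (circPos L hL p x : AddCircle L) = x := by
  have : Fact (0 < L) := ⟨hL⟩
  have : ((circPos L hL p x : ℝ) : AddCircle L) = x - p := AddCircle.coe_equivIco
  rw [this]; abel

theorem hca_eq_of_coe_eq {L : ℝ} {a b : ℝ} (h : (a : AddCircle L) = b)
    (h1 : a < b + L) (h2 : b < a + L) : a = b := by
  obtain ⟨n, hn⟩ := (hca_coe_eq_iff a b).1 h
  have hL : 0 < L := by linarith
  have h3 : (n : ℝ) < 1 := by by_contra hc; push Not at hc; nlinarith
  have h4 : (-1 : ℝ) < n := by by_contra hc; push Not at hc; nlinarith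
  have h5 : n < 1 := by exact_mod_cast h3
  have h6 : -1 < n := by exact_mod_cast h4
  have : n = 0 := by omega
  subst this
  simpa using hn

theorem hca_circPos_add {L : ℝ} (hL : 0 < L) (p : AddCircle L) (s : ℝ) (h0 : 0 ≤ s) (h1 : s < L) :
    circPos L hL p (p + (s : AddCircle L)) = s := by
  have h := hca_circPos_spec hL p (p + (s : AddCircle L))
  have h' := add_left_cancel h
  have := hca_circPos_nonneg hL p (p + (s : AddCircle L))
  have := hca_circPos_lt hL p (p + (s : AddCircle L))
  exact hca_eq_of_coe_eq h' (by linarith) (by linarith)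

theorem hca_circPos_self {L : ℝ} (hL : 0 < L) (p : AddCircle L) : circPos L hL p p = 0 := by
  have := hca_circPos_add hL p 0 le_rfl hL
  simpa using this

theorem hca_arc_preconnected {L : ℝ} (t : AddCircle L) (l : ℝ) : IsPreconnected (Arc L t l) := by
  have : Arc L t l = (fun s : ℝ => t + (s : AddCircle L)) '' Icc 0 l := by
    ext x
    constructor
    · rintro ⟨s, h0, h1, h⟩
      exact ⟨s, ⟨h0, h1⟩, h.symm⟩
    · rintro ⟨s, ⟨h0, h1⟩, h⟩
      exact ⟨s, h0, h1, h.symm⟩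
  rw [this]
  apply isPreconnected_Icc.image
  exact (continuous_const.add (AddCircle.continuous_mk' L)).continuousOn

theorem hca_arc_compl_preconnected {L : ℝ} (hL : 0 < L) (t : AddCircle L) (l : ℝ) (h0l : 0 ≤ l) :
    IsPreconnected (Arc L t l)ᶜ := by
  have : (Arc L t l)ᶜ = (fun s : ℝ => t + (s : AddCircle L)) '' Ioo l L := by
    ext x
    constructor
    · intro hx
      refine ⟨circPos L hL t x, ⟨?_, hca_circPos_lt hL t x⟩, hca_circPos_spec hL t x⟩
      by_contra hc
      push Not at hc
      exact hx ⟨_, hca_circPos_nonneg hL t x, hc, (hca_circPos_spec hL t x).symm⟩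
    · rintro ⟨s, ⟨h0, h1⟩, rfl⟩ ⟨s', h0', h1', h⟩
      have := hca_eq_of_coe_eq (add_left_cancel h) (by linarith) (by linarith)
      linarith
  rw [this]
  apply isPreconnected_Ioo.image
  exact (continuous_const.add (AddCircle.continuous_mk' L)).continuousOn

theorem hca_arc_tail_inj {L : ℝ} (t t' : AddCircle L) (l l' : ℝ)
    (h0 : 0 ≤ l) (h1 : l < L) (h0' : 0 ≤ l')
    (h : Arc L t l = Arc L t' l') : t = t' := by
  have ht : t ∈ Arc L t' l' := by rw [← h]; exact ⟨0, le_rfl, h0, by simp⟩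
  have ht' : t' ∈ Arc L t l := by rw [h]; exact ⟨0, le_rfl, h0', by simp⟩
  obtain ⟨s, hs0, hs1, hs⟩ := ht'
  by_cases hz : s = 0
  · subst hz; simpa using hs.symm
  exfalso
  -- `t = t' + (L - s)`
  have hLs : t = t' + ((L - s : ℝ) : AddCircle L) := by
    rw [hs, add_assoc, ← AddCircle.coe_add]; simp
  obtain ⟨s', hs0', hs1', hs'⟩ := ht
  have hspos : 0 < s := lt_of_le_of_ne hs0 (Ne.symm hz)
  have hle : L - s ≤ l' := by
    by_cases hs'L : s' < L
    · have := hca_eq_of_coe_eq (add_left_cancel (hLs.symm.trans hs')) (by linarith) (by linarith)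
      linarith
    · linarith
  have hm : t + (((l + L) / 2 : ℝ) : AddCircle L) ∈ Arc L t' l' := by
    refine ⟨(l + L) / 2 - s, by linarith, by linarith, ?_⟩
    rw [hs, add_assoc, ← AddCircle.coe_add]; congr 2; ring
  rw [← h] at hm
  obtain ⟨r, hr0, hr1, hr⟩ := hm
  have := hca_eq_of_coe_eq (add_left_cancel hr) (by linarith) (by linarith)
  linarith

/-- A preconnected set of the circle cannot alternate. -/
theorem hca_no_alternate {L : ℝ} (p : AddCircle L) {J : Set (AddCircle L)} (hJ : IsPreconnected J)
    (x1 x2 x3 x4 : ℝ) (h12 : x1 < x2) (h23 : x2 < x3) (h34 : x3 < x4) (h41 : x4 < x1 + L)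
    (n1 : p + (x1 : AddCircle L) ∉ J) (m2 : p + (x2 : AddCircle L) ∈ J)
    (n3 : p + (x3 : AddCircle L) ∉ J) (m4 : p + (x4 : AddCircle L) ∈ J) : False := by
  have hL : 0 < L := by linarith
  have hop : IsOpenMap (fun s : ℝ => p + (s : AddCircle L)) :=
    (Homeomorph.addLeft p).isOpenMap.comp (QuotientAddGroup.isOpenMap_coe)
  have := hJ _ _ (hop _ (isOpen_Ioo (a := x1) (b := x3))) (hop _ (isOpen_Ioo (a := x3) (b := x1 + L)))
    ?_ ⟨_, m2, x2, ⟨h12, h23⟩, rfl⟩ ⟨_, m4, x4, ⟨h34, h41⟩, rfl⟩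
  · obtain ⟨_, _, ⟨a, ⟨ha, ha'⟩, rfl⟩, ⟨b, ⟨hb, hb'⟩, hab⟩⟩ := this
    have := hca_eq_of_coe_eq (add_left_cancel hab) (by linarith) (by linarith)
    linarith
  · intro y hy
    have hs := hca_circPos_spec hL (p + (x1 : AddCircle L)) y
    set s := circPos L hL (p + (x1 : AddCircle L)) y
    have h0 : 0 ≤ s := hca_circPos_nonneg hL _ y
    have h1 : s < L := hca_circPos_lt hL _ y
    rw [add_assoc, ← AddCircle.coe_add] at hs
    have hs0 : s ≠ 0 := by
      intro h; rw [h] at hs; apply n1; rw [add_zero] at hs; rw [hs]; exact hy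
    have hs0' : 0 < s := lt_of_le_of_ne h0 (Ne.symm hs0)
    have hs1 : x1 + s ≠ x3 := by
      intro h; rw [h] at hs; apply n3; rw [hs]; exact hy
    rcases lt_or_gt_of_ne hs1 with h | h
    · left; exact ⟨x1 + s, ⟨by linarith, h⟩, hs⟩
    · right; exact ⟨x1 + s, ⟨h, by linarith⟩, hs⟩

/-! ### Cyclic consecutiveness -/

theorem hca_consec_iff_int {α : Type*} {k : ℕ} (hk : 0 < k) (e : α ≃ Fin k) (T : Set α)  :
    CyclicConsec (zOrd e) T ↔ ∃ a b : ℤ, ∀ C, C ∈ T ↔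
      ∃ n : ℤ, a ≤ ((e C : ℕ) : ℤ) + n * k ∧ ((e C : ℕ) : ℤ) + n * k ≤ b := by
  have : NeZero k := ⟨hk.ne'⟩
  constructor
  · rintro ⟨a, m, rfl⟩
    refine ⟨(a.val : ℤ), (a.val : ℤ) + m - 1, fun C => ?_⟩
    have ha : ((a.val : ℤ) : ZMod k) = a := by simp
    constructor
    · rintro ⟨i, hi, h⟩
      have h2 : (((e C : ℕ) : ℤ) : ZMod k) = (((a.val : ℤ) + i : ℤ) : ZMod k) := by
        rw [Int.cast_add, ha]; simpa [zOrd] using h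
      rw [ZMod.intCast_eq_intCast_iff_dvd_sub] at h2
      obtain ⟨n, hn⟩ := h2
      refine ⟨n, ?_, ?_⟩ <;> rw [mul_comm] <;> omega
    · rintro ⟨n, h1, h2⟩
      refine ⟨(((e C : ℕ) : ℤ) + n * k - a.val).toNat, by omega, ?_⟩
      have h3 : ((((((e C : ℕ) : ℤ) + n * k - a.val).toNat : ℕ) : ℤ) : ZMod k)
        = ((((e C : ℕ) : ℤ) + n * k - a.val : ℤ) : ZMod k) := by
        congr 1; omega
      rw [Int.cast_natCast] at h3
      rw [h3]
      push_cast
      simp [zOrd]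
  · rintro ⟨a, b, h⟩
    refine ⟨(a : ZMod k), (b - a + 1).toNat, ?_⟩
    ext C
    rw [h]
    constructor
    · rintro ⟨n, h1, h2⟩
      refine ⟨(((e C : ℕ) : ℤ) + n * k - a).toNat, by omega, ?_⟩
      have h3 : ((((((e C : ℕ) : ℤ) + n * k - a).toNat : ℕ) : ℤ) : ZMod k)
        = ((((e C : ℕ) : ℤ) + n * k - a : ℤ) : ZMod k) := by
        congr 1; omega
      rw [Int.cast_natCast] at h3
      rw [h3]
      push_cast
      simp [zOrd]
    · rintro ⟨i, hi, h⟩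
      have h2 : (((e C : ℕ) : ℤ) : ZMod k) = ((a + i : ℤ) : ZMod k) := by
        rw [Int.cast_add]; simpa [zOrd] using h
      rw [ZMod.intCast_eq_intCast_iff_dvd_sub] at h2
      obtain ⟨n, hn⟩ := h2
      refine ⟨n, ?_, ?_⟩ <;> rw [mul_comm] <;> omega

theorem hca_consec_no_alternate {α : Type*} {k : ℕ} (e : α ≃ Fin k) (T : Set α)
    (h : CyclicConsec (zOrd e) T) (C1 C2 C3 C4 : α) (h12 : e C1 < e C2) (h23 : e C2 < e C3)
    (h34 : e C3 < e C4) (n1 : C1 ∉ T) (m2 : C2 ∈ T) (n3 : C3 ∉ T) (m4 : C4 ∈ T) : False := by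
  have hk : 0 < k := (e C1).pos
  obtain ⟨a, b, hab⟩ := (hca_consec_iff_int hk e T).1 h
  rw [hab] at n1 m2 n3 m4
  obtain ⟨n, hn1, hn2⟩ := m2
  obtain ⟨m, hm1, hm2⟩ := m4
  have := (e C4).isLt
  rw [Fin.lt_def] at h12 h23 h34
  rcases lt_or_ge m n with hmn | hmn
  · apply n1
    have : (m + 1) * (k : ℤ) ≤ n * k := by
      apply mul_le_mul_of_nonneg_right <;> omega
    rw [add_mul, one_mul] at this
    exact ⟨n, by omega, by omega⟩
  · apply n3
    have : n * (k : ℤ) ≤ m * k := by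
      apply mul_le_mul_of_nonneg_right <;> omega
    exact ⟨n, by omega, by omega⟩

theorem hca_consec_of_no_alternate {α : Type*} {k : ℕ} (hk : 0 < k) (e : α ≃ Fin k) (T : Set α)
    (h1 : ∀ C1 C2 C3 C4 : α, e C1 < e C2 → e C2 < e C3 → e C3 < e C4 →
      C1 ∉ T → C2 ∈ T → C3 ∉ T → C4 ∈ T → False)
    (h2 : ∀ C1 C2 C3 C4 : α, e C1 < e C2 → e C2 < e C3 → e C3 < e C4 →
      C1 ∈ T → C2 ∉ T → C3 ∈ T → C4 ∉ T → False) :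
    CyclicConsec (zOrd e) T := by
  have : Finite α := Finite.of_equiv _ e.symm
  rw [hca_consec_iff_int hk]
  have hlt : ∀ C : α, ((e C : ℕ) : ℤ) < k := fun C => by exact_mod_cast (e C).isLt
  have hinj : ∀ C C' : α, (e C : ℕ) = e C' → C = C' := fun C C' h => e.injective (Fin.ext h)
  have key : ∀ (C : α) (n : ℤ), 0 ≤ ((e C : ℕ) : ℤ) + n * k → ((e C : ℕ) : ℤ) + n * k < k → n = 0 := by
    intro C n ha hb
    have := hlt C
    have h3 : n < 1 := by by_contra hc; push Not at hc; nlinarith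
    have h4 : -1 < n := by
      by_contra hc; push Not at hc
      nlinarith
    omega
  by_cases hT : T.Nonempty
  swap
  · rw [Set.not_nonempty_iff_eq_empty] at hT
    refine ⟨1, 0, fun C => ?_⟩
    simp [hT]
    intros; omega
  by_cases hTc : Tᶜ.Nonempty
  swap
  · rw [Set.not_nonempty_iff_eq_empty, Set.compl_empty_iff] at hTc
    refine ⟨0, k, fun C => ?_⟩
    simp only [hTc, mem_univ, true_iff]
    have := hlt C
    exact ⟨0, by omega, by omega⟩
  set Z : α := e.symm ⟨0, hk⟩ with hZ
  have hZ0 : (e Z : ℕ) = 0 := by simp [hZ]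
  by_cases h0 : Z ∈ T
  · obtain ⟨c, hc, hcm⟩ := Set.exists_min_image Tᶜ (fun C => e C) (Set.toFinite _) hTc
    obtain ⟨d, hd, hdm⟩ := Set.exists_max_image Tᶜ (fun C => e C) (Set.toFinite _) hTc
    have hcd := hcm d hd
    rw [Fin.le_def] at hcd
    refine ⟨(e d : ℕ) + 1 - k, (e c : ℕ) - 1, fun C => ?_⟩
    have hC := hlt C
    have hd' := hlt d
    constructor
    · intro hCT
      by_cases hlt' : (e C : ℕ) < e c
      · exact ⟨0, by omega, by omega⟩
      · have hne : (e C : ℕ) ≠ e c := fun h => hc (hinj _ _ h ▸ hCT)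
        have hne' : (e C : ℕ) ≠ e d := fun h => hd (hinj _ _ h ▸ hCT)
        have hgt : (e d : ℕ) < e C := by
          by_contra hcon
          refine h2 Z c C d ?_ ?_ ?_ h0 hc hCT hd <;> rw [Fin.lt_def]
          · have : (e Z : ℕ) ≠ e c := fun h => hc (hinj _ _ h ▸ h0)
            omega
          · omega
          · omega
        exact ⟨-1, by omega, by omega⟩
    · rintro ⟨n, ha, hb⟩
      by_contra hCT
      have h3 := hcm C hCT
      have h4 := hdm C hCT
      simp only [Fin.le_def] at h3 h4
      have h5 : n < 0 := by by_contra hc; push Not at hc; nlinarith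
      have h6 : -1 < n := by
        by_contra hc; push Not at hc
        nlinarith
      omega
  · obtain ⟨c, hc, hcm⟩ := Set.exists_min_image T (fun C => e C) (Set.toFinite _) hT
    obtain ⟨d, hd, hdm⟩ := Set.exists_max_image T (fun C => e C) (Set.toFinite _) hT
    refine ⟨(e c : ℕ), (e d : ℕ), fun C => ?_⟩
    have hC := hlt C
    have hd' := hlt d
    constructor
    · intro hCT
      have h3 := hcm C hCT
      have h4 := hdm C hCT
      simp only [Fin.le_def] at h3 h4
      exact ⟨0, by omega, by omega⟩
    · rintro ⟨n, ha, hb⟩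
      have hn := key C n (by omega) (by omega)
      subst hn
      by_contra hCT
      have hne : (e C : ℕ) ≠ e c := fun h => hCT (hinj _ _ h ▸ hc)
      have hne' : (e C : ℕ) ≠ e d := fun h => hCT (hinj _ _ h ▸ hd)
      have hne'' : (e Z : ℕ) ≠ e c := fun h => h0 (hinj _ _ h ▸ hc)
      refine h1 Z c C d ?_ ?_ ?_ h0 hc hCT hd <;> rw [Fin.lt_def] <;> omega

/-! ### Regions, gaps and maximal cliques -/

theorem hca_exists_maxClique {V : Type*} [Finite V] (G : SimpleGraph V) (S : Set V)
    (hS : G.IsClique S) : ∃ C, IsMaxClique G C ∧ S ⊆ C := by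
  obtain ⟨C, hSC, hC⟩ := Finite.exists_le_maximal (p := fun C : Set V => G.IsClique C) hS
  exact ⟨C, ⟨hC.1, fun D hD hCD => Set.Subset.antisymm hCD (hC.2 hD hCD)⟩, hSC⟩

theorem hca_mem_of_adj_all {V : Type*} {G : SimpleGraph V} {C : Set V} (hC : IsMaxClique G C)
    (v : V) (h : ∀ u ∈ C, u ≠ v → G.Adj u v) : v ∈ C := by
  have hcl : G.IsClique (insert v C) := by
    rw [SimpleGraph.isClique_insert]
    exact ⟨hC.1, fun b hb hne => (h b hb hne.symm).symm⟩
  rw [hC.2 _ hcl (Set.subset_insert v C)]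
  exact Set.mem_insert v C

theorem hca_reg_of_forall {V : Type*} {G : SimpleGraph V} {L : ℝ} (R' : PartialCARep G L)
    (C : Set V) (p : AddCircle L) (h : ∀ v ∈ R'.pre, (p ∈ R'.arc v ↔ v ∈ C)) : p ∈ R'.Reg C := by
  constructor
  · rintro A ⟨v, ⟨hv, hvC⟩, rfl⟩
    exact (h v hv).2 hvC
  · rintro ⟨A, ⟨⟨v, hv, rfl⟩, hn⟩, hp⟩
    exact hn ⟨v, ⟨hv, (h v hv).1 hp⟩, rfl⟩

theorem hca_forall_of_reg {V : Type*} {G : SimpleGraph V} {L : ℝ} (R' : PartialCARep G L)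
    (hdist : ∀ u ∈ R'.pre, ∀ v ∈ R'.pre,
      R'.tail u ≠ R'.head v ∧ (u ≠ v → R'.tail u ≠ R'.tail v ∧ R'.head u ≠ R'.head v))
    (C : Set V) (p : AddCircle L) (hp : p ∈ R'.Reg C) : ∀ v ∈ R'.pre, (p ∈ R'.arc v ↔ v ∈ C) := by
  intro v hv
  constructor
  · intro hpv
    by_contra hvC
    apply hp.2
    refine ⟨R'.arc v, ⟨⟨v, hv, rfl⟩, ?_⟩, hpv⟩
    rintro ⟨u, ⟨hu, huC⟩, huv⟩
    have hne : u ≠ v := fun h => hvC (h ▸ huC)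
    refine ((hdist u hu v hv).2 hne).1 ?_
    exact (hca_arc_tail_inj _ _ _ _ (R'.len_nonneg v hv) (R'.len_lt v hv)
      (R'.len_nonneg u hu) huv).symm
  · intro hvC
    exact hp.1 _ ⟨v, ⟨hv, hvC⟩, rfl⟩

theorem hca_reg_eq_of_pre {V : Type*} {G : SimpleGraph V} {L : ℝ} (R' : PartialCARep G L)
    (C C' : Set V) (h : R'.PreArcs C = R'.PreArcs C') : R'.Reg C = R'.Reg C' := by
  unfold PartialCARep.Reg PartialCARep.RegPlus PartialCARep.RegMinus
  rw [h]

/-- A region different from `Reg(C)` lies in a single gap of `C`. -/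
theorem hca_reg_single_gap {V : Type*} {G : SimpleGraph V} {L : ℝ} (R' : PartialCARep G L)
    (C C' : Set V) (h : R'.Reg C ≠ R'.Reg C') (x : AddCircle L) (hx : x ∈ R'.Reg C') :
    R'.Reg C' ⊆ connectedComponentIn (R'.Reg C)ᶜ x := by
  have hpre : R'.PreArcs C ≠ R'.PreArcs C' := fun h' => h (hca_reg_eq_of_pre R' C C' h')
  suffices ∃ A : Set (AddCircle L), IsPreconnected A ∧ R'.Reg C' ⊆ A ∧ A ⊆ (R'.Reg C)ᶜ by
    obtain ⟨A, hA, h1, h2⟩ := this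
    exact h1.trans (hA.subset_connectedComponentIn (h1 hx) h2)
  by_cases hsub : R'.PreArcs C ⊆ R'.PreArcs C'
  · have hns : ¬ R'.PreArcs C' ⊆ R'.PreArcs C := fun h' => hpre (Set.Subset.antisymm hsub h')
    obtain ⟨A, hA, hA'⟩ := Set.not_subset.1 hns
    obtain ⟨v, ⟨hv, hvC⟩, rfl⟩ := id hA
    refine ⟨R'.arc v, hca_arc_preconnected _ _, fun y hy => hy.1 _ hA, fun y hy hyC => ?_⟩
    exact hyC.2 ⟨_, ⟨⟨v, hv, rfl⟩, hA'⟩, hy⟩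
  · obtain ⟨A, hA, hA'⟩ := Set.not_subset.1 hsub
    obtain ⟨v, ⟨hv, hvC⟩, rfl⟩ := id hA
    refine ⟨(R'.arc v)ᶜ, hca_arc_compl_preconnected R'.hL _ _ (R'.len_nonneg v hv),
      fun y hy hyA => ?_, fun y hy hyC => hy (hyC.1 _ hA)⟩
    exact hy.2 ⟨_, ⟨⟨v, hv, rfl⟩, hA'⟩, hyA⟩

/-! ### Forward direction -/

theorem hca_exists_enum {α : Type*} [Finite α] (f : α → ℝ) (hf : Function.Injective f) :
    ∃ (k : ℕ) (e : α ≃ Fin k), ∀ C C', e C < e C' ↔ f C < f C' := by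
  let _ : LinearOrder α := LinearOrder.lift' f hf
  have _ : Fintype α := Fintype.ofFinite _
  refine ⟨_, (Fintype.orderIsoFinOfCardEq α rfl).toEquiv.symm, fun C C' => ?_⟩
  exact (Fintype.orderIsoFinOfCardEq α rfl).symm.lt_iff_lt

theorem hca_forward {V : Type*} [Fintype V] (G : SimpleGraph V)
    (L : ℝ) (R' : PartialCARep G L)
    (D : Set V) (hD : IsMaxClique G D)
    (R : CARep G L) (hext : R.Extends R') (hHel : R.Helly) :
    ∃ pD ∈ R'.Reg D, ∃ (k : ℕ) (e : {C : Set V // IsMaxClique G C} ≃ Fin k),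
      (∀ C : {C : Set V // IsMaxClique G C}, C ≠ ⟨D, hD⟩ → e ⟨D, hD⟩ < e C) ∧
      (∀ C C' : {C : Set V // IsMaxClique G C}, C.1 ≠ D → C'.1 ≠ D →
        (∀ x ∈ R'.Reg C.1, ∀ y ∈ R'.Reg C'.1,
          circPos L R'.hL pD x < circPos L R'.hL pD y) →
        e C < e C') ∧
      (∀ v : V, CyclicConsec (zOrd e) {C : {C : Set V // IsMaxClique G C} | v ∈ C.1}) ∧
      (∀ C : Set V, IsMaxClique G C → ∀ J : Set (AddCircle L), R'.IsGap C J →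
        CyclicConsec (zOrd e) {C' : {C : Set V // IsMaxClique G C} | R'.Reg C'.1 ⊆ J}) := by
  classical
  have hself : ∀ v, (R.arc v).Nonempty := fun v =>
    ⟨R.tail v, 0, le_rfl, R.len_nonneg v, by simp⟩
  have hpt : ∀ C : {C : Set V // IsMaxClique G C}, ∃ p : AddCircle L, ∀ v, p ∈ R.arc v ↔ v ∈ C.1 := by
    rintro ⟨C, hC⟩
    have : ∃ p : AddCircle L, ∀ v ∈ C, p ∈ R.arc v := by
      by_cases hne : C.Nonempty
      · obtain ⟨p, hp⟩ := hHel C hne (fun u hu v hv => by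
          by_cases huv : u = v
          · subst huv; rw [Set.inter_self]; exact hself u
          · exact (R.inter_iff u v huv).2 (hC.1 hu hv huv))
        exact ⟨p, fun v hv => Set.mem_iInter₂.1 hp v hv⟩
      · exact ⟨0, fun v hv => absurd ⟨v, hv⟩ hne⟩
    obtain ⟨p, hp⟩ := this
    refine ⟨p, fun v => ⟨fun hv => ?_, hp v⟩⟩
    exact hca_mem_of_adj_all hC v (fun u hu huv => (R.inter_iff u v huv).1 ⟨p, hp u hu, hv⟩)
  choose p hp using hpt
  have hpinj : Function.Injective p := by
    intro C C' h
    apply Subtype.ext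
    ext v
    rw [← hp, ← hp, h]
  have hreg : ∀ C, p C ∈ R'.Reg C.1 := fun C =>
    hca_reg_of_forall R' C.1 (p C) (fun v hv => by rw [← hext v hv]; exact hp C v)
  set pD := p ⟨D, hD⟩ with hpD
  set f : {C : Set V // IsMaxClique G C} → ℝ := fun C => circPos L R'.hL pD (p C) with hf
  have hfinj : Function.Injective f := by
    intro C C' h
    apply hpinj
    rw [← hca_circPos_spec R'.hL pD (p C), ← hca_circPos_spec R'.hL pD (p C')]
    exact congrArg (fun s : ℝ => pD + (s : AddCircle L)) h
  have hspec : ∀ C, pD + (f C : AddCircle L) = p C := fun C => hca_circPos_spec R'.hL pD (p C)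
  have hf0 : ∀ C, 0 ≤ f C := fun C => hca_circPos_nonneg R'.hL pD (p C)
  have hfL : ∀ C, f C < L := fun C => hca_circPos_lt R'.hL pD (p C)
  -- the enumeration
  obtain ⟨k, e, he⟩ : ∃ (k : ℕ) (e : {C : Set V // IsMaxClique G C} ≃ Fin k),
      ∀ C C', e C < e C' ↔ f C < f C' := by
    exact hca_exists_enum f hfinj
  have hk : 0 < k := (e ⟨D, hD⟩).pos
  have hcon : ∀ J : Set (AddCircle L), IsPreconnected J →
      CyclicConsec (zOrd e) {C | p C ∈ J} := by
    intro J hJ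
    apply hca_consec_of_no_alternate hk
    · intro C1 C2 C3 C4 h12 h23 h34 n1 m2 n3 m4
      simp only [he] at h12 h23 h34
      have := hf0 C1
      have := hfL C4
      refine hca_no_alternate pD hJ _ _ _ _ h12 h23 h34 (by linarith) ?_ ?_ ?_ ?_ <;>
      rw [hspec] <;> assumption
    · intro C1 C2 C3 C4 h12 h23 h34 m1 n2 m3 n4
      simp only [he] at h12 h23 h34
      have := hf0 C1
      have := hfL C4
      refine hca_no_alternate pD hJ (f C4 - L) (f C1) (f C2) (f C3) (by linarith) h12 h23
        (by linarith) ?_ ?_ ?_ ?_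
      · have : ((f C4 - L : ℝ) : AddCircle L) = (f C4 : AddCircle L) := by
          rw [AddCircle.coe_sub]; simp
        rw [this, hspec]; exact n4
      all_goals rw [hspec]; assumption
  refine ⟨pD, hreg ⟨D, hD⟩, k, e, ?_, ?_, ?_, ?_⟩
  · intro C hC
    rw [he]
    have h0 : f ⟨D, hD⟩ = 0 := hca_circPos_self R'.hL pD
    have : f C ≠ f ⟨D, hD⟩ := fun h => hC (hfinj h)
    rw [h0] at this ⊢
    exact lt_of_le_of_ne (hf0 C) this.symm
  · intro C C' _ _ h
    rw [he]
    exact h _ (hreg C) _ (hreg C')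
  · intro v
    have := hcon (R.arc v) (hca_arc_preconnected _ _)
    simpa only [hp] using this
  · rintro C hC J ⟨x, hx, rfl⟩
    have := hcon _ (isPreconnected_connectedComponentIn (x := x) (F := (R'.Reg C)ᶜ))
    convert this using 1
    ext C'
    constructor
    · intro h
      exact h (hreg C')
    · intro h
      have h1 := connectedComponentIn_eq h
      change R'.Reg C'.1 ⊆ _
      rw [h1]
      apply hca_reg_single_gap _ _ _ _ _ (hreg C')
      intro heq
      have h2 := connectedComponentIn_subset _ _ h
      exact h2 (heq ▸ hreg C')

/-! ### Backward direction: weakly ordered points -/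

theorem hca_exists_cells (E : Finset ℝ) : ∃ c : ℝ → ℕ, Monotone c ∧
    ∀ x y, x < y → c x = c y → ∀ z ∈ E, ¬ (x ≤ z ∧ z ≤ y) := by
  classical
  have m1 : ∀ x y : ℝ, x ≤ y → E.filter (· < x) ⊆ E.filter (· < y) := by
    intro x y h z hz
    rw [Finset.mem_filter] at hz ⊢
    exact ⟨hz.1, lt_of_lt_of_le hz.2 h⟩
  have m2 : ∀ x y : ℝ, x ≤ y → E.filter (· ≤ x) ⊆ E.filter (· ≤ y) := by
    intro x y h z hz
    rw [Finset.mem_filter] at hz ⊢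
    exact ⟨hz.1, hz.2.trans h⟩
  refine ⟨fun x => (E.filter (· < x)).card + (E.filter (· ≤ x)).card, ?_, ?_⟩
  · intro x y h
    exact Nat.add_le_add (Finset.card_le_card (m1 x y h)) (Finset.card_le_card (m2 x y h))
  · rintro x y hxy hc z hz ⟨hxz, hzy⟩
    have l1 := Finset.card_le_card (m1 x y hxy.le)
    have l2 := Finset.card_le_card (m2 x y hxy.le)
    dsimp only at hc
    have e1 := Finset.eq_of_subset_of_card_le (m1 x y hxy.le) (by omega)
    have e2 := Finset.eq_of_subset_of_card_le (m2 x y hxy.le) (by omega)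
    rcases hxz.lt_or_eq with h | h
    · have : z ∈ E.filter (· ≤ y) := Finset.mem_filter.2 ⟨hz, hzy⟩
      rw [← e2, Finset.mem_filter] at this
      linarith [this.2]
    · have : z ∈ E.filter (· < y) := Finset.mem_filter.2 ⟨hz, by linarith⟩
      rw [← e1, Finset.mem_filter] at this
      linarith [this.2]

theorem hca_exists_circle_cells {V : Type*} [Fintype V] {G : SimpleGraph V} {L : ℝ}
    (R' : PartialCARep G L) (p : AddCircle L) : ∃ c : ℝ → ℕ, Monotone c ∧
    ∀ x y, 0 ≤ x → x < L → 0 ≤ y → y < L → c x = c y → ∀ C : Set V,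
      (p + (x : AddCircle L) ∈ R'.Reg C → p + (y : AddCircle L) ∈ R'.Reg C) := by
  classical
  obtain ⟨c, hc, hcE⟩ := hca_exists_cells
    ((Finset.univ.image (fun v => circPos L R'.hL p (R'.tail v))) ∪
     (Finset.univ.image (fun v => circPos L R'.hL p (R'.head v))))
  refine ⟨c, hc, ?_⟩
  have key : ∀ x y, 0 ≤ x → y < L → x < y → c x = c y → ∀ v : V,
      (p + (x : AddCircle L) ∈ R'.arc v ↔ p + (y : AddCircle L) ∈ R'.arc v) := by
    intro x y hx hy hxy hcxy v
    constructor
    · rintro ⟨s, hs0, hs1, hs⟩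
      by_cases hle : s + (y - x) ≤ R'.len v
      · refine ⟨s + (y - x), by linarith, hle, ?_⟩
        rw [AddCircle.coe_add, ← add_assoc, ← hs, add_assoc, ← AddCircle.coe_add]
        congr 2; ring
      · exfalso
        have hh : R'.head v = p + ((x + (R'.len v - s) : ℝ) : AddCircle L) := by
          rw [AddCircle.coe_add, ← add_assoc, hs, add_assoc, ← AddCircle.coe_add]
          unfold PartialCARep.head
          congr 2; ring
        have h2 := hca_circPos_add R'.hL p (x + (R'.len v - s)) (by linarith) (by linarith)
        rw [← hh] at h2
        refine hcE x y hxy hcxy (circPos L R'.hL p (R'.head v)) ?_ ⟨by linarith, by linarith⟩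
        exact Finset.mem_union_right _ (Finset.mem_image_of_mem _ (Finset.mem_univ v))
    · rintro ⟨s, hs0, hs1, hs⟩
      by_cases hle : y - x ≤ s
      · refine ⟨s - (y - x), by linarith, by linarith, ?_⟩
        rw [AddCircle.coe_sub, ← add_sub_assoc, ← hs, AddCircle.coe_sub]
        abel
      · exfalso
        have hh : R'.tail v = p + ((y - s : ℝ) : AddCircle L) := by
          rw [AddCircle.coe_sub, ← add_sub_assoc, hs]; abel
        have h2 := hca_circPos_add R'.hL p (y - s) (by linarith) (by linarith)
        rw [← hh] at h2
        refine hcE x y hxy hcxy (circPos L R'.hL p (R'.tail v)) ?_ ⟨by linarith, by linarith⟩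
        exact Finset.mem_union_left _ (Finset.mem_image_of_mem _ (Finset.mem_univ v))
  have key2 : ∀ x y, 0 ≤ x → x < L → 0 ≤ y → y < L → c x = c y → ∀ v : V,
      (p + (x : AddCircle L) ∈ R'.arc v ↔ p + (y : AddCircle L) ∈ R'.arc v) := by
    intro x y hx hx' hy hy' h v
    rcases lt_trichotomy x y with hl | hl | hl
    · exact key x y hx hy' hl h v
    · rw [hl]
    · exact (key y x hy hx' hl h.symm v).symm
  intro x y hx hx' hy hy' h C hC
  have h2 := key2 x y hx hx' hy hy' h
  constructor
  · rintro A ⟨v, hv, rfl⟩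
    exact (h2 v).1 (hC.1 _ ⟨v, hv, rfl⟩)
  · rintro ⟨A, ⟨⟨v, hv, rfl⟩, hA⟩, hyA⟩
    exact hC.2 ⟨_, ⟨⟨v, hv, rfl⟩, hA⟩, (h2 v).2 hyA⟩

theorem hca_nat_min (Q : ℕ → Prop) (h : ∃ l, Q l) : ∃ l, Q l ∧ ∀ j < l, ¬ Q j := by
  classical
  exact ⟨Nat.find h, Nat.find_spec h, fun m hm => Nat.find_min h hm⟩

theorem hca_greedy (k : ℕ) (K : ℕ → Set ℕ) (n0 : ℕ) (h0 : n0 ∈ K 0)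
    (hne : ∀ i < k, (K i).Nonempty) (hmin : ∀ i < k, ∀ m ∈ K i, n0 ≤ m)
    (hbad : ∀ l i, l + 1 < i → i < k → ∀ a ∈ K l, ∀ b ∈ K (l + 1), ∀ y ∈ K i, a ≤ y → y < b →
      (∀ m ∈ K (l + 1), a ≤ m → b ≤ m) → (∀ m ∈ K i, m < b) → False) :
    ∃ n : ℕ → ℕ, (∀ i < k, n i ∈ K i) ∧ ∀ i, i + 1 < k → n i ≤ n (i + 1) := by
  classical
  let n : ℕ → ℕ := fun i => Nat.rec n0 (fun i r => sInf {m | m ∈ K (i + 1) ∧ r ≤ m}) i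
  have hn0 : n 0 = n0 := rfl
  have hns : ∀ i, n (i + 1) = sInf {m | m ∈ K (i + 1) ∧ n i ≤ m} := fun i => rfl
  have main : ∀ i, i < k → n i ∈ K i ∧
      ∀ j, j + 1 = i → n j ≤ n i ∧ ∀ m ∈ K i, n j ≤ m → n i ≤ m := by
    intro i
    induction i using Nat.strong_induction_on with
    | _ i ih =>
    intro hik
    cases i with
    | zero => exact ⟨h0, fun j hj => by omega⟩
    | succ i =>
      have hnon : {m | m ∈ K (i + 1) ∧ n i ≤ m}.Nonempty := by
        by_contra hcon
        rw [Set.not_nonempty_iff_eq_empty, Set.eq_empty_iff_forall_notMem] at hcon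
        have hall : ∀ m ∈ K (i + 1), m < n i := fun m hm => by
          by_contra hc; exact hcon m ⟨hm, by omega⟩
        have hex : ∃ l, l ≤ i ∧ ∀ m ∈ K (i + 1), m < n l := ⟨i, le_rfl, hall⟩
        obtain ⟨l, ⟨hl1, hl2⟩, hlmin⟩ : ∃ l, (l ≤ i ∧ ∀ m ∈ K (i + 1), m < n l) ∧
            ∀ j < l, ¬ (j ≤ i ∧ ∀ m ∈ K (i + 1), m < n j) :=
          hca_nat_min _ hex
        cases l with
        | zero =>
          obtain ⟨m, hm⟩ := hne (i + 1) hik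
          have := hl2 m hm
          have := hmin (i + 1) hik m hm
          omega
        | succ l =>
          have h3 := hlmin l (by omega)
          have h4 : ∃ y ∈ K (i + 1), n l ≤ y := by
            by_contra hc
            push Not at hc
            exact h3 ⟨by omega, hc⟩
          obtain ⟨y, hy, hly⟩ := h4
          have ihl := ih l (by omega) (by omega)
          have ihl1 := ih (l + 1) (by omega) (by omega)
          exact hbad l (i + 1) (by omega) hik (n l) ihl.1 (n (l + 1)) ihl1.1 y hy hly (hl2 y hy)
            (ihl1.2 l rfl).2 hl2
      have hmem := Nat.sInf_mem hnon
      rw [← hns] at hmem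
      refine ⟨hmem.1, fun j hj => ?_⟩
      obtain rfl : j = i := by omega
      refine ⟨hmem.2, fun m hm hjm => ?_⟩
      rw [hns]
      exact Nat.sInf_le ⟨hm, hjm⟩
  exact ⟨n, fun i hi => (main i hi).1, fun i hi => ((main (i + 1) hi).2 i rfl).1⟩

theorem hca_weak_points {V : Type*} [Fintype V] (G : SimpleGraph V)
    (L : ℝ) (R' : PartialCARep G L)
    (D : Set V) (hD : IsMaxClique G D) (pD : AddCircle L) (hpD : pD ∈ R'.Reg D)
    (k : ℕ) (e : {C : Set V // IsMaxClique G C} ≃ Fin k)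
    (he1 : ∀ C : {C : Set V // IsMaxClique G C}, C ≠ ⟨D, hD⟩ → e ⟨D, hD⟩ < e C)
    (he2 : ∀ C C' : {C : Set V // IsMaxClique G C}, C.1 ≠ D → C'.1 ≠ D →
        (∀ x ∈ R'.Reg C.1, ∀ y ∈ R'.Reg C'.1,
          circPos L R'.hL pD x < circPos L R'.hL pD y) →
        e C < e C')
    (hgap : ∀ C : Set V, IsMaxClique G C → ∀ J : Set (AddCircle L), R'.IsGap C J →
        CyclicConsec (zOrd e) {C' : {C : Set V // IsMaxClique G C} | R'.Reg C'.1 ⊆ J}) :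
    ∃ x : {C : Set V // IsMaxClique G C} → ℝ, (∀ C, 0 ≤ x C ∧ x C < L) ∧
      (∀ C, pD + (x C : AddCircle L) ∈ R'.Reg C.1) ∧ ∀ C C', e C ≤ e C' → x C ≤ x C' := by
  classical
  have hL := R'.hL
  obtain ⟨c, hc, hcR⟩ := hca_exists_circle_cells R' pD
  have hclt : ∀ x y, c x < c y → x < y := fun x y h => by
    by_contra hcon
    have := hc (not_lt.1 hcon)
    omega
  have hk : 0 < k := (e ⟨D, hD⟩).pos
  have heD : (e ⟨D, hD⟩ : ℕ) = 0 := by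
    by_contra hne
    have hC : e.symm ⟨0, hk⟩ ≠ ⟨D, hD⟩ := by
      intro h; rw [← h] at hne; simp at hne
    have := he1 _ hC
    rw [Fin.lt_def] at this
    simp at this
  have hneD : ∀ C, 0 < (e C : ℕ) → C.1 ≠ D := by
    rintro ⟨C, hC⟩ h rfl
    have h' : (e ⟨C, hC⟩ : ℕ) = 0 := heD
    omega
  -- regions are nonempty
  have hregne : ∀ C : {C : Set V // IsMaxClique G C}, (R'.Reg C.1).Nonempty := by
    intro C
    by_cases hCD : C.1 = D
    · rw [hCD]; exact ⟨pD, hpD⟩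
    · by_contra hemp
      rw [Set.not_nonempty_iff_eq_empty] at hemp
      have := he2 C C hCD hCD (by rw [hemp]; intro x hx; exact absurd hx (Set.notMem_empty x))
      exact lt_irrefl _ this
  let K : ℕ → Set ℕ := fun i => {m | ∃ C : {C : Set V // IsMaxClique G C}, (e C : ℕ) = i ∧
    ∃ x : ℝ, 0 ≤ x ∧ x < L ∧ pD + (x : AddCircle L) ∈ R'.Reg C.1 ∧ c x = m}
  have hKe : ∀ (C : {C : Set V // IsMaxClique G C}) (m : ℕ), m ∈ K (e C) →
      ∃ x : ℝ, 0 ≤ x ∧ x < L ∧ pD + (x : AddCircle L) ∈ R'.Reg C.1 ∧ c x = m := by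
    rintro C m ⟨C', hC', h⟩
    obtain rfl : C' = C := e.injective (Fin.ext hC')
    exact h
  obtain ⟨n, hn, hmono⟩ := hca_greedy k K (c 0)
    ⟨⟨D, hD⟩, heD, 0, le_rfl, hL, by simpa using hpD, rfl⟩
    (by
      intro i hi
      obtain ⟨y, hy⟩ := hregne (e.symm ⟨i, hi⟩)
      refine ⟨_, e.symm ⟨i, hi⟩, by simp, circPos L hL pD y, hca_circPos_nonneg _ _ _,
        hca_circPos_lt _ _ _, ?_, rfl⟩
      rw [hca_circPos_spec]; exact hy)
    (by
      rintro i hi m ⟨C, hC, x, hx0, hxL, hx, rfl⟩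
      exact hc hx0)
    (by
      rintro l i hli hik _ ⟨A, hA, xa, ha0, haL, haR, rfl⟩ _ ⟨B, hB, xb, hb0, hbL, hbR, rfl⟩ _
        ⟨Y, hY, xy, hy0, hyL, hyR, rfl⟩ hay hyb hbmin hYb
      -- normalise so that `xa ≤ xy`
      obtain ⟨xa', ha0', haL', haR', hca', hay'⟩ : ∃ xa' : ℝ, 0 ≤ xa' ∧ xa' < L ∧
          pD + (xa' : AddCircle L) ∈ R'.Reg A.1 ∧ c xa' = c xa ∧ xa' ≤ xy := by
        rcases hay.lt_or_eq with h | h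
        · exact ⟨xa, ha0, haL, haR, rfl, (hclt _ _ h).le⟩
        · exact ⟨xy, hy0, hyL, hcR xa xy ha0 haL hy0 hyL h _ haR, h.symm, le_rfl⟩
      have hxyb := hclt _ _ hyb
      have hBreg : ∀ z, 0 ≤ z → z < L → pD + (z : AddCircle L) ∈ R'.Reg B.1 →
          c z < c xa ∨ c xb ≤ c z := by
        intro z hz0 hzL hz
        by_cases hcz : c z < c xa
        · exact Or.inl hcz
        · exact Or.inr (hbmin _ ⟨B, hB, z, hz0, hzL, hz, rfl⟩ (by omega))
      have hbetw : ∀ z, xa' ≤ z → z ≤ xy → pD + (z : AddCircle L) ∉ R'.Reg B.1 := by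
        intro z hz1 hz2 hz
        have h1 := hc hz1
        have h2 := hc hz2
        rcases hBreg z (by linarith) (by linarith) hz with h | h <;> omega
      by_cases hex : ∃ x, 0 ≤ x ∧ x < L ∧ pD + (x : AddCircle L) ∈ R'.Reg B.1 ∧ c x < c xa
      · obtain ⟨x, hx0, hxL, hxR, hxa⟩ := hex
        have hxxa : x < xa' := hclt _ _ (by omega)
        let J := connectedComponentIn (R'.Reg B.1)ᶜ (pD + (xy : AddCircle L))
        have hyB : pD + (xy : AddCircle L) ∈ (R'.Reg B.1)ᶜ := hbetw xy hay' le_rfl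
        have hJ : R'.IsGap B.1 J := ⟨_, hyB, rfl⟩
        have hJc : IsPreconnected J := isPreconnected_connectedComponentIn
        have hJs : J ⊆ (R'.Reg B.1)ᶜ := connectedComponentIn_subset _ _
        have hxaJ : pD + (xa' : AddCircle L) ∈ J := by
          have himg : IsPreconnected ((fun s : ℝ => pD + (s : AddCircle L)) '' Icc xa' xy) :=
            isPreconnected_Icc.image _
              (continuous_const.add (AddCircle.continuous_mk' L)).continuousOn
          refine himg.subset_connectedComponentIn ⟨xy, ⟨hay', le_rfl⟩, rfl⟩ ?_
            ⟨xa', ⟨le_rfl, hay'⟩, rfl⟩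
          rintro _ ⟨z, ⟨hz1, hz2⟩, rfl⟩
          exact hbetw z hz1 hz2
        have hYJ : R'.Reg Y.1 ⊆ J := by
          apply hca_reg_single_gap _ _ _ _ _ hyR
          intro h; rw [← h] at hyR; exact hyB hyR
        have hAJ : R'.Reg A.1 ⊆ J := by
          change R'.Reg A.1 ⊆ connectedComponentIn _ _
          rw [connectedComponentIn_eq hxaJ]
          apply hca_reg_single_gap _ _ _ _ _ haR'
          intro h; rw [← h] at haR'; exact hJs hxaJ haR'
        have hBJ : ¬ R'.Reg B.1 ⊆ J := fun h => hJs (h hbR) hbR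
        have hDJ : ¬ R'.Reg D ⊆ J := by
          intro h
          have hpJ : pD + ((0 : ℝ) : AddCircle L) ∈ J := by simpa using h hpD
          have hx0' : 0 < x := by
            refine lt_of_le_of_ne hx0 ?_
            rintro rfl
            exact hJs hpJ hxR
          have hpJ' : pD + ((L : ℝ) : AddCircle L) ∈ J := by
            rw [AddCircle.coe_period]; simpa using hpJ
          exact hca_no_alternate pD hJc x xa' xb L hxxa (by linarith) hbL (by linarith)
            (fun h => hJs h hxR) hxaJ (fun h => hJs h hbR) hpJ'
        have hDA : e ⟨D, hD⟩ < e A := by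
          apply he1
          rintro rfl
          exact hDJ hAJ
        refine hca_consec_no_alternate e _ (hgap B.1 B.2 J hJ) ⟨D, hD⟩ A B Y hDA ?_ ?_
          hDJ hAJ hBJ hYJ <;> rw [Fin.lt_def] <;> omega
      · have hall : ∀ z, 0 ≤ z → z < L → pD + (z : AddCircle L) ∈ R'.Reg B.1 → c xb ≤ c z := by
          intro z hz0 hzL hz
          rcases hBreg z hz0 hzL hz with h | h
          · exact absurd ⟨z, hz0, hzL, hz, h⟩ hex
          · exact h
        have := he2 Y B (hneD Y (by omega)) (hneD B (by omega)) (by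
          intro y hy z hz
          apply hclt
          have h1 := hall (circPos L hL pD z) (hca_circPos_nonneg _ _ _) (hca_circPos_lt _ _ _)
            (by rw [hca_circPos_spec]; exact hz)
          have h2 := hYb (c (circPos L hL pD y)) ⟨Y, hY, _, hca_circPos_nonneg hL pD y,
            hca_circPos_lt hL pD y, by rw [hca_circPos_spec]; exact hy, rfl⟩
          omega)
        rw [Fin.lt_def] at this
        omega)
  have hmono' : ∀ i j, i ≤ j → j < k → n i ≤ n j := by
    intro i j hij
    induction j, hij using Nat.le_induction with
    | base => intro _; exact le_rfl
    | succ j hij ih => intro hj; exact (ih (by omega)).trans (hmono j hj)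
  have hz : ∀ m : ℕ, ∃ z : ℝ, (∃ x : ℝ, 0 ≤ x ∧ x < L ∧ c x = m) → 0 ≤ z ∧ z < L ∧ c z = m := by
    intro m
    by_cases h : ∃ x : ℝ, 0 ≤ x ∧ x < L ∧ c x = m
    · obtain ⟨x, hx⟩ := h
      exact ⟨x, fun _ => hx⟩
    · exact ⟨0, fun h' => absurd h' h⟩
  choose z hz using hz
  have hzC : ∀ C, 0 ≤ z (n (e C)) ∧ z (n (e C)) < L ∧ c (z (n (e C))) = n (e C) ∧
      pD + (z (n (e C)) : AddCircle L) ∈ R'.Reg C.1 := by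
    intro C
    obtain ⟨x, hx0, hxL, hxR, hxc⟩ := hKe C (n (e C)) (hn _ (e C).isLt)
    obtain ⟨h1, h2, h3⟩ := hz (n (e C)) ⟨x, hx0, hxL, hxc⟩
    exact ⟨h1, h2, h3, hcR x _ hx0 hxL h1 h2 (by rw [hxc, h3]) _ hxR⟩
  refine ⟨fun C => z (n (e C)), fun C => ⟨(hzC C).1, (hzC C).2.1⟩, fun C => (hzC C).2.2.2, ?_⟩
  intro C C' h
  have h1 := hmono' (e C) (e C') h (e C').isLt
  rcases h1.lt_or_eq with h2 | h2
  · apply le_of_lt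
    apply hclt
    rw [(hzC C).2.2.1, (hzC C').2.2.1]
    exact h2
  · simp only [h2, le_refl]

/-! ### Backward direction: strictly ordered points -/

theorem hca_exists_pos_min {ι : Type*} [Finite ι] (f : ι → ℝ) (hf : ∀ i, 0 < f i) :
    ∃ ε : ℝ, 0 < ε ∧ ∀ i, ε ≤ f i := by
  by_cases h : Nonempty ι
  · obtain ⟨i, hi⟩ := Finite.exists_min f
    exact ⟨f i, hf i, hi⟩
  · exact ⟨1, one_pos, fun i => absurd ⟨i⟩ h⟩

theorem hca_mem_arc_add {L : ℝ} (t : AddCircle L) (l r : ℝ) (hl0 : 0 ≤ l) (hl : l < L)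
    (hr0 : 0 ≤ r) (hr : r < L) : (t + (r : AddCircle L) ∈ Arc L t l) ↔ r ≤ l := by
  constructor
  · rintro ⟨s, h0, h1, h⟩
    have := hca_eq_of_coe_eq (add_left_cancel h) (by linarith) (by linarith)
    linarith
  · intro h
    exact ⟨r, hr0, h, rfl⟩

theorem hca_arc_right {L : ℝ} (hL : 0 < L) (t z : AddCircle L) (l : ℝ) (hl0 : 0 ≤ l) (hl : l < L)
    (hz : z ≠ t + (l : AddCircle L)) :
    ∃ ε : ℝ, 0 < ε ∧ ∀ s, 0 < s → s < ε → (z + (s : AddCircle L) ∈ Arc L t l ↔ z ∈ Arc L t l) := by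
  have h0 := hca_circPos_nonneg hL t z
  have h1 := hca_circPos_lt hL t z
  have h2 := hca_circPos_spec hL t z
  generalize circPos L hL t z = r at h0 h1 h2
  subst h2
  rcases lt_trichotomy r l with h | h | h
  · refine ⟨l - r, by linarith, fun s hs0 hs => ?_⟩
    rw [add_assoc, ← AddCircle.coe_add, hca_mem_arc_add t l _ hl0 hl (by linarith) (by linarith),
      hca_mem_arc_add t l _ hl0 hl h0 h1]
    constructor <;> intro <;> linarith
  · exact absurd (by rw [h]) hz
  · refine ⟨L - r, by linarith, fun s hs0 hs => ?_⟩
    rw [add_assoc, ← AddCircle.coe_add, hca_mem_arc_add t l _ hl0 hl (by linarith) (by linarith),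
      hca_mem_arc_add t l _ hl0 hl h0 h1]
    constructor <;> intro <;> linarith

theorem hca_arc_left {L : ℝ} (hL : 0 < L) (t z : AddCircle L) (l : ℝ) (hl0 : 0 ≤ l) (hl : l < L)
    (hz : z ≠ t) :
    ∃ ε : ℝ, 0 < ε ∧ ∀ s, 0 < s → s < ε →
      (z + ((-s : ℝ) : AddCircle L) ∈ Arc L t l ↔ z ∈ Arc L t l) := by
  have h0 := hca_circPos_nonneg hL t z
  have h1 := hca_circPos_lt hL t z
  have h2 := hca_circPos_spec hL t z
  generalize circPos L hL t z = r at h0 h1 h2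
  subst h2
  have hr : 0 < r := by
    refine lt_of_le_of_ne h0 ?_
    rintro rfl
    exact hz (by simp)
  rcases le_or_gt r l with h | h
  · refine ⟨r, hr, fun s hs0 hs => ?_⟩
    rw [add_assoc, ← AddCircle.coe_add, hca_mem_arc_add t l _ hl0 hl (by linarith) (by linarith),
      hca_mem_arc_add t l _ hl0 hl h0 h1]
    constructor <;> intro <;> linarith
  · refine ⟨r - l, by linarith, fun s hs0 hs => ?_⟩
    rw [add_assoc, ← AddCircle.coe_add, hca_mem_arc_add t l _ hl0 hl (by linarith) (by linarith),
      hca_mem_arc_add t l _ hl0 hl h0 h1]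
    constructor <;> intro <;> linarith

theorem hca_direction {V : Type*} [Finite V] {G : SimpleGraph V} {L : ℝ} (R' : PartialCARep G L)
    (hdist : ∀ u ∈ R'.pre, ∀ v ∈ R'.pre, R'.tail u ≠ R'.head v) (z : AddCircle L) :
    ∃ δ ε : ℝ, (δ = 0 ∨ δ = 1) ∧ 0 < ε ∧ ∀ η, 0 < η → η ≤ ε → ∀ w, 0 < w → w < 1 →
      ∀ v ∈ R'.pre, (z + ((η * (w - δ) : ℝ) : AddCircle L) ∈ R'.arc v ↔ z ∈ R'.arc v) := by
  have hlt : ∀ η w : ℝ, 0 < η → 0 < w → w < 1 → η * w < η := fun η w h1 h2 h3 => by nlinarith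
  by_cases hz : ∃ v ∈ R'.pre, z = R'.head v
  · obtain ⟨v0, hv0, hz⟩ := hz
    have : ∀ v : R'.pre, ∃ ε : ℝ, 0 < ε ∧ ∀ s, 0 < s → s < ε →
        (z + ((-s : ℝ) : AddCircle L) ∈ R'.arc v ↔ z ∈ R'.arc v) := fun v =>
      hca_arc_left R'.hL _ _ _ (R'.len_nonneg v v.2) (R'.len_lt v v.2)
        (by rw [hz]; exact (hdist v v.2 v0 hv0).symm)
    choose f hf0 hf using this
    obtain ⟨ε, hε, hεf⟩ := hca_exists_pos_min f hf0
    refine ⟨1, ε, Or.inr rfl, hε, fun η h0 h1 w hw0 hw1 v hv => ?_⟩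
    have h2 := hf ⟨v, hv⟩ (η * (1 - w)) (mul_pos h0 (by linarith))
      (lt_of_lt_of_le (hlt η (1 - w) h0 (by linarith) (by linarith)) (h1.trans (hεf _)))
    rw [← h2]
    have : η * (w - 1) = -(η * (1 - w)) := by ring
    rw [this]
  · push Not at hz
    have : ∀ v : R'.pre, ∃ ε : ℝ, 0 < ε ∧ ∀ s, 0 < s → s < ε →
        (z + (s : AddCircle L) ∈ R'.arc v ↔ z ∈ R'.arc v) := fun v =>
      hca_arc_right R'.hL _ _ _ (R'.len_nonneg v v.2) (R'.len_lt v v.2) (hz v v.2)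
    choose f hf0 hf using this
    obtain ⟨ε, hε, hεf⟩ := hca_exists_pos_min f hf0
    refine ⟨0, ε, Or.inl rfl, hε, fun η h0 h1 w hw0 hw1 v hv => ?_⟩
    rw [sub_zero]
    exact hf ⟨v, hv⟩ (η * w) (mul_pos h0 hw0)
      (lt_of_lt_of_le (hlt η w h0 hw0 hw1) (h1.trans (hεf _)))

theorem hca_strict_points {V : Type*} [Finite V] {G : SimpleGraph V} {L : ℝ}
    (R' : PartialCARep G L)
    (hdist : ∀ u ∈ R'.pre, ∀ v ∈ R'.pre, R'.tail u ≠ R'.head v)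
    {α : Type*} [Finite α] {k : ℕ} (e : α ≃ Fin k) (pD : AddCircle L) (x : α → ℝ)
    (hx : ∀ C, 0 ≤ x C ∧ x C < L) (hmono : ∀ C C', e C ≤ e C' → x C ≤ x C') :
    ∃ y : α → ℝ, (∀ C C', e C < e C' → y C < y C') ∧ (∀ C C', y C < y C' + L) ∧
      ∀ C, ∀ v ∈ R'.pre, (pD + (y C : AddCircle L) ∈ R'.arc v ↔
        pD + (x C : AddCircle L) ∈ R'.arc v) := by
  classical
  choose δ ε hδ hε hdir using hca_direction R' hdist
  obtain ⟨η1, hη1, hη1'⟩ := hca_exists_pos_min (fun C => ε (pD + (x C : AddCircle L)))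
    (fun C => hε _)
  obtain ⟨η2, hη2, hη2'⟩ := hca_exists_pos_min (fun C => (L - x C) / 2)
    (fun C => by linarith [(hx C).2])
  obtain ⟨η3, hη3, hη3'⟩ := hca_exists_pos_min
    (fun q : α × α => if x q.1 < x q.2 then (x q.2 - x q.1) / 2 else 1)
    (fun q => by split_ifs with h <;> linarith)
  obtain ⟨η, hη, h1, h2, h3⟩ : ∃ η : ℝ, 0 < η ∧ η ≤ η1 ∧ η ≤ η2 ∧ η ≤ η3 :=
    ⟨min η1 (min η2 η3), by positivity, min_le_left _ _, (min_le_right _ _).trans (min_le_left _ _),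
      (min_le_right _ _).trans (min_le_right _ _)⟩
  let w : α → ℝ := fun C => ((e C : ℕ) + 1 : ℝ) / (k + 1)
  have hk1 : (0 : ℝ) < k + 1 := by positivity
  have hw0 : ∀ C, 0 < w C := fun C => by positivity
  have hw1 : ∀ C, w C < 1 := fun C => by
    rw [div_lt_one hk1]
    have : ((e C : ℕ) : ℝ) < k := by exact_mod_cast (e C).isLt
    linarith
  have hwm : ∀ C C', e C < e C' → w C < w C' := fun C C' h => by
    have : ((e C : ℕ) : ℝ) < ((e C' : ℕ) : ℝ) := by exact_mod_cast h
    apply div_lt_div_of_pos_right _ hk1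
    linarith
  have hδ0 : ∀ z, 0 ≤ δ z := fun z => by rcases hδ z with h | h <;> rw [h] <;> norm_num
  have hδ1 : ∀ z, δ z ≤ 1 := fun z => by rcases hδ z with h | h <;> rw [h]; norm_num
  let y : α → ℝ := fun C => x C + η * (w C - δ (pD + (x C : AddCircle L)))
  have hyu : ∀ C, y C < x C + η := fun C => by
    have := hδ0 (pD + (x C : AddCircle L))
    have := hw1 C
    have : η * (w C - δ (pD + (x C : AddCircle L))) < η * 1 := by
      apply mul_lt_mul_of_pos_left _ hη; linarith
    change x C + _ < _
    linarith
  have hyl : ∀ C, x C - η < y C := fun C => by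
    have := hδ1 (pD + (x C : AddCircle L))
    have := hw0 C
    have : η * (-1) < η * (w C - δ (pD + (x C : AddCircle L))) := by
      apply mul_lt_mul_of_pos_left _ hη; linarith
    change _ < x C + _
    linarith
  refine ⟨y, ?_, ?_, ?_⟩
  · intro C C' h
    rcases (hmono C C' h.le).lt_or_eq with hlt | heq
    · have := hη3' (C, C')
      simp only [hlt, if_true] at this
      have := hyu C
      have := hyl C'
      linarith
    · change x C + η * (w C - δ (pD + (x C : AddCircle L))) <
        x C' + η * (w C' - δ (pD + (x C' : AddCircle L)))
      rw [heq]
      have := mul_lt_mul_of_pos_left (hwm C C' h) hη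
      linarith
  · intro C C'
    have := hη2' C
    have := hyu C
    have := hyl C'
    have := (hx C').1
    linarith
  · intro C v hv
    have := hdir (pD + (x C : AddCircle L)) η hη (h1.trans (hη1' C)) (w C) (hw0 C) (hw1 C) v hv
    rw [add_assoc, ← AddCircle.coe_add] at this
    exact this

/-! ### Backward direction: construction of the representation -/

theorem hca_periodic_ext {α : Type*} {k : ℕ} (hk : 0 < k) (e : α ≃ Fin k) {L : ℝ} (y : α → ℝ)
    (h1 : ∀ C C', e C < e C' → y C < y C') (h2 : ∀ C C', y C < y C' + L) :
    ∃ P : ℤ → ℝ, StrictMono P ∧ (∀ C (n : ℤ), P ((e C : ℕ) + n * k) = y C + n * L) ∧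
      (∀ a : ℤ, ∃ C, ∃ n : ℤ, a = (e C : ℕ) + n * k) := by
  have hkz : (0 : ℤ) < k := by exact_mod_cast hk
  have hm : ∀ a : ℤ, (a % k).toNat < k := fun a => by
    have := Int.emod_lt_of_pos a hkz
    have := Int.emod_nonneg a hkz.ne'
    omega
  let F : ℤ → α := fun a => e.symm ⟨(a % k).toNat, hm a⟩
  have hF : ∀ a : ℤ, ((e (F a) : ℕ) : ℤ) = a % k := fun a => by
    have := Int.emod_nonneg a hkz.ne'
    simp [F, this]
  have hFa : ∀ a : ℤ, a = (e (F a) : ℕ) + (a / k) * k := fun a => by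
    rw [hF]
    have := Int.emod_add_mul_ediv a k
    linarith [mul_comm (a / (k : ℤ)) k]
  let P : ℤ → ℝ := fun a => y (F a) + ((a / k : ℤ) : ℝ) * L
  refine ⟨P, ?_, ?_, fun a => ⟨F a, a / k, hFa a⟩⟩
  · intro a b hab
    change y (F a) + ((a / k : ℤ) : ℝ) * L < y (F b) + ((b / k : ℤ) : ℝ) * L
    have hle : a / (k : ℤ) ≤ b / k := Int.ediv_le_ediv hkz hab.le
    rcases hle.lt_or_eq with h | h
    · have hr : ((a / k : ℤ) : ℝ) + 1 ≤ ((b / k : ℤ) : ℝ) := by exact_mod_cast h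
      have hL : 0 < L := by linarith [h2 (F a) (F a)]
      have := h2 (F a) (F b)
      nlinarith
    · have ha := hFa a
      have hb := hFa b
      rw [← h] at hb ⊢
      have hlt : e (F a) < e (F b) := by rw [Fin.lt_def]; omega
      linarith [h1 _ _ hlt]
  · intro C n
    have hC : ((e C : ℕ) : ℤ) < k := by exact_mod_cast (e C).isLt
    have hd : (((e C : ℕ) : ℤ) + n * k) / k = n := by
      rw [Int.add_mul_ediv_right _ _ hkz.ne', Int.ediv_eq_zero_of_lt (by omega) hC]; simp
    have hm' : (((e C : ℕ) : ℤ) + n * k) % k = (e C : ℕ) := by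
      rw [Int.add_mul_emod_self_right, Int.emod_eq_of_lt (by omega) hC]
    have hFC : F ((e C : ℕ) + n * k) = C := by
      apply e.injective
      apply Fin.ext
      have := hF (((e C : ℕ) : ℤ) + n * k)
      rw [hm'] at this
      exact_mod_cast this
    change y (F _) + ((_ / _ : ℤ) : ℝ) * L = _
    rw [hFC, hd]

theorem hca_construct {V : Type*} [Fintype V] (G : SimpleGraph V)
    (L : ℝ) (R' : PartialCARep G L) (k : ℕ) (hk : 0 < k)
    (e : {C : Set V // IsMaxClique G C} ≃ Fin k) (y : {C : Set V // IsMaxClique G C} → ℝ)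
    (h1 : ∀ C C', e C < e C' → y C < y C') (h2 : ∀ C C', y C < y C' + L)
    (hreg : ∀ C, ∀ v ∈ R'.pre, ((y C : AddCircle L) ∈ R'.arc v ↔ v ∈ C.1))
    (hcon : ∀ v : V, CyclicConsec (zOrd e) {C : {C : Set V // IsMaxClique G C} | v ∈ C.1}) :
    ∃ R : CARep G L, R.Extends R' ∧ R.Helly := by
  classical
  have hL := R'.hL
  have hkz : (0 : ℤ) < k := by exact_mod_cast hk
  obtain ⟨P, hP, hPe, hPs⟩ := hca_periodic_ext hk e y h1 h2
  have hvC : ∀ v : V, ∃ C : {C : Set V // IsMaxClique G C}, v ∈ C.1 := by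
    intro v
    obtain ⟨C, hC, hv⟩ := hca_exists_maxClique G {v} (by simp [SimpleGraph.IsClique])
    exact ⟨⟨C, hC⟩, hv rfl⟩
  have hPk : ∀ a : ℤ, P (a + k) = P a + L := by
    intro a
    obtain ⟨C, n, rfl⟩ := hPs a
    have : ((e C : ℕ) : ℤ) + n * k + k = (e C : ℕ) + (n + 1) * k := by ring
    rw [this, hPe, hPe]; push_cast; ring
  -- the arcs
  have harc : ∀ v : V, ∃ t l : ℝ, 0 ≤ l ∧ l < L ∧
      (∀ C, ((y C : AddCircle L) ∈ Arc L (t : AddCircle L) l ↔ v ∈ C.1)) ∧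
      (v ∈ R'.pre → (t : AddCircle L) = R'.tail v ∧ l = R'.len v) ∧
      (v ∉ R'.pre → ∃ a b : ℤ, t = P a ∧ t + l = P b) := by
    intro v
    by_cases hv : v ∈ R'.pre
    · obtain ⟨t, ht⟩ := hca_exists_lift (R'.tail v)
      refine ⟨t, R'.len v, R'.len_nonneg v hv, R'.len_lt v hv, fun C => ?_, fun _ => ⟨ht, rfl⟩,
        fun h => absurd hv h⟩
      rw [ht]
      exact hreg C v hv
    · obtain ⟨a, b, hab⟩ := (hca_consec_iff_int hk e _).1 (hcon v)
      obtain ⟨C0, hC0⟩ := hvC v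
      obtain ⟨n0, hn1, hn2⟩ := (hab C0).1 hC0
      have hle : a ≤ min b (a + k - 1) := by
        rw [le_min_iff]; omega
      refine ⟨P a, P (min b (a + k - 1)) - P a, ?_, ?_, ?_, fun h => absurd h hv, fun _ =>
        ⟨a, min b (a + k - 1), rfl, by ring⟩⟩
      · linarith [hP.monotone hle]
      · have : min b (a + k - 1) < a + k := lt_of_le_of_lt (min_le_right _ _) (by omega)
        have := hP this
        rw [hPk] at this
        linarith
      · intro C
        rw [hca_mem_arc]
        have h3 := hab C
        rw [Set.mem_setOf_eq] at h3
        rw [h3]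
        constructor
        · rintro ⟨n, h4, h5⟩
          rw [← hPe] at h4 h5
          rw [add_sub_cancel] at h5
          refine ⟨n, hP.le_iff_le.1 h4, ?_⟩
          exact (hP.le_iff_le.1 h5).trans (min_le_left _ _)
        · rintro ⟨n, h4, h5⟩
          -- shift into the window `[a, a + k)`
          have h6 := Int.emod_add_mul_ediv (((e C : ℕ) : ℤ) + n * k - a) k
          have h7 := Int.emod_lt_of_pos (((e C : ℕ) : ℤ) + n * k - a) hkz
          have h8 := Int.emod_nonneg (((e C : ℕ) : ℤ) + n * k - a) hkz.ne'
          have h9 : 0 ≤ (((e C : ℕ) : ℤ) + n * k - a) / k := Int.ediv_nonneg (by omega) (by omega)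
          generalize (((e C : ℕ) : ℤ) + n * k - a) / k = q at h6 h9
          generalize (((e C : ℕ) : ℤ) + n * k - a) % k = r at h6 h7 h8
          have h10 : ((e C : ℕ) : ℤ) + (n - q) * k = a + r := by
            rw [sub_mul, mul_comm q]; omega
          have h11 : 0 ≤ (k : ℤ) * q := mul_nonneg hkz.le h9
          refine ⟨n - q, ?_, ?_⟩
          · rw [← hPe]; apply hP.monotone; omega
          · rw [← hPe, add_sub_cancel]; apply hP.monotone
            rw [le_min_iff]; omega
  choose t l hl0 hlL hmem hpre hnpre using harc
  -- the key intersection statement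
  have hendpt : ∀ (a : ℤ) (u v : V), (P a : AddCircle L) ∈ Arc L (t u : AddCircle L) (l u) →
      (P a : AddCircle L) ∈ Arc L (t v : AddCircle L) (l v) →
      ∃ C : {C : Set V // IsMaxClique G C}, u ∈ C.1 ∧ v ∈ C.1 := by
    intro a u v hu hv
    obtain ⟨C, n, rfl⟩ := hPs a
    have h3 : ((P (((e C : ℕ) : ℤ) + n * k) : ℝ) : AddCircle L) = (y C : AddCircle L) := by
      rw [hPe, hca_coe_eq_iff]; exact ⟨n, rfl⟩
    rw [h3, hmem] at hu hv
    exact ⟨C, hu, hv⟩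
  have hmeet : ∀ u v : V, u ∉ R'.pre → (Arc L (t u : AddCircle L) (l u) ∩
      Arc L (t v : AddCircle L) (l v)).Nonempty →
      ∃ C : {C : Set V // IsMaxClique G C}, u ∈ C.1 ∧ v ∈ C.1 := by
    rintro u v hu ⟨z, hzu, hzv⟩
    obtain ⟨a, b, ha, hb⟩ := hnpre u hu
    obtain ⟨z, rfl⟩ := hca_exists_lift z
    rw [hca_mem_arc] at hzu hzv
    obtain ⟨n, hn1, hn2⟩ := hzu
    obtain ⟨m, hm1, hm2⟩ := hzv
    by_cases hc1 : t v ≤ t u + ((m - n : ℤ) : ℝ) * L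
    · apply hendpt a u v
      · rw [hca_mem_arc]; exact ⟨0, by simp [ha], by simp [ha, hl0]⟩
      · rw [hca_mem_arc, ← ha]; refine ⟨m - n, hc1, ?_⟩; push_cast; linarith
    · by_cases hc2 : t u + l u + ((m - n : ℤ) : ℝ) * L ≤ t v + l v
      · apply hendpt b u v
        · rw [hca_mem_arc, ← hb]; exact ⟨0, by simp [hl0], by simp⟩
        · rw [hca_mem_arc, ← hb]; refine ⟨m - n, ?_, hc2⟩; push_cast; linarith
      · obtain ⟨C, hC⟩ := hvC v
        refine ⟨C, ?_, hC⟩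
        rw [← hmem, hca_mem_arc] at hC ⊢
        obtain ⟨j, hj1, hj2⟩ := hC
        push Not at hc1 hc2
        push_cast at hc1 hc2
        refine ⟨j - (m - n), ?_, ?_⟩ <;> push_cast <;> linarith
  let R : CARep G L :=
    { hL := hL
      tail := fun v => (t v : AddCircle L)
      len := l
      len_nonneg := hl0
      len_lt := hlL
      inter_iff := by
        intro u v huv
        constructor
        · intro h
          by_cases hu : u ∈ R'.pre
          · by_cases hv : v ∈ R'.pre
            · rw [(hpre u hu).1, (hpre u hu).2, (hpre v hv).1, (hpre v hv).2] at h
              exact (R'.inter_iff u hu v hv huv).1 h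
            · rw [Set.inter_comm] at h
              obtain ⟨C, hC1, hC2⟩ := hmeet v u hv h
              exact C.2.1 hC2 hC1 huv
          · obtain ⟨C, hC1, hC2⟩ := hmeet u v hu h
            exact C.2.1 hC1 hC2 huv
        · intro h
          obtain ⟨C, hC, hs⟩ := hca_exists_maxClique G {u, v} (by
            rw [SimpleGraph.isClique_pair]; exact fun _ => h)
          exact ⟨y ⟨C, hC⟩, (hmem u ⟨C, hC⟩).2 (hs (by simp)), (hmem v ⟨C, hC⟩).2 (hs (by simp))⟩ }
  refine ⟨R, ?_, ?_⟩
  · intro v hv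
    change Arc L (t v : AddCircle L) (l v) = Arc L (R'.tail v) (R'.len v)
    rw [(hpre v hv).1, (hpre v hv).2]
  · intro S _ hS
    obtain ⟨C, hC, hs⟩ := hca_exists_maxClique G S (by
      intro u hu v hv huv
      exact (R.inter_iff u v huv).1 (hS u hu v hv))
    refine ⟨y ⟨C, hC⟩, Set.mem_iInter₂.2 fun v hv => ?_⟩
    exact (hmem v ⟨C, hC⟩).2 (hs hv)

end Helpers

/-- Characterization of extendable partial Helly circular-arc
representations whose predrawn arcs have pairwise distinct endpoints: with `D` a
maximal clique, `R'` is extendable iff there is a point `p_D ∈ Reg(D)` such that the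
partial order `≺` (with `D` minimum, and `C ≺ C'` whenever all of `Reg(C)` strictly
precedes all of `Reg(C')` in the order obtained by cutting the circle at `p_D`) has a
linear extension (given by the enumeration `e`) such that (1) every `M_v` is
consecutive in the induced cyclic order, and (2) every gap set `S_J` is consecutive. -/
theorem hca_extension_characterization {V : Type*} [Fintype V] (G : SimpleGraph V)
    (L : ℝ) (R' : PartialCARep G L) (hH : R'.Helly)
    (hdist : ∀ u ∈ R'.pre, ∀ v ∈ R'.pre,
      R'.tail u ≠ R'.head v ∧ (u ≠ v → R'.tail u ≠ R'.tail v ∧ R'.head u ≠ R'.head v))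
    (D : Set V) (hD : IsMaxClique G D) :
    (∃ R : CARep G L, R.Extends R' ∧ R.Helly) ↔
    ∃ pD ∈ R'.Reg D, ∃ (k : ℕ) (e : {C : Set V // IsMaxClique G C} ≃ Fin k),
      -- `e` is a linear extension of `≺`: `D` comes first …
      (∀ C : {C : Set V // IsMaxClique G C}, C ≠ ⟨D, hD⟩ → e ⟨D, hD⟩ < e C) ∧
      -- … and it respects the strict precedence of regions after cutting at `p_D`
      (∀ C C' : {C : Set V // IsMaxClique G C}, C.1 ≠ D → C'.1 ≠ D →
        (∀ x ∈ R'.Reg C.1, ∀ y ∈ R'.Reg C'.1,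
          circPos L R'.hL pD x < circPos L R'.hL pD y) →
        e C < e C') ∧
      -- (1)
      (∀ v : V, CyclicConsec (zOrd e) {C : {C : Set V // IsMaxClique G C} | v ∈ C.1}) ∧
      -- (2)
      (∀ C : Set V, IsMaxClique G C → ∀ J : Set (AddCircle L), R'.IsGap C J →
        CyclicConsec (zOrd e) {C' : {C : Set V // IsMaxClique G C} | R'.Reg C'.1 ⊆ J}) := by
  have _ := hH
  constructor
  · rintro ⟨R, hext, hHel⟩
    exact hca_forward G L R' D hD R hext hHel
  · rintro ⟨pD, hpD, k, e, he1, he2, hM, hgap⟩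
    obtain ⟨x, hx, hxR, hxm⟩ := hca_weak_points G L R' D hD pD hpD k e he1 he2 hgap
    obtain ⟨y, hy1, hy2, hy3⟩ := hca_strict_points R' (fun u hu v hv => (hdist u hu v hv).1) e pD x
      hx hxm
    obtain ⟨q, rfl⟩ := hca_exists_lift pD
    refine hca_construct G L R' k (e ⟨D, hD⟩).pos e (fun C => q + y C)
      (fun C C' h => by linarith [hy1 C C' h]) (fun C C' => by linarith [hy2 C C']) ?_ hM
    intro C v hv
    rw [AddCircle.coe_add, hy3 C v hv]
    exact hca_forall_of_reg R' hdist C.1 _ (hxR C) v hv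
end
end
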